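/- Let f ∈ H(b) satisfy inf_{z∈D} |f(z)| > 0. Then f is cyclic for S_b. -/

import Mathlib

open MeasureTheory Complex Filter Set Metric
open scoped ComplexConjugate

noncomputable section

/-- The circle group `ℝ / 2πℤ`, parametrizing the unit circle `𝕋`. -/
instance fact_two_pi_pos : Fact (0 < 2 * Real.pi) := ⟨by positivity⟩

abbrev Tc : Type := AddCircle (2 * Real.pi)

/-- Normalized Lebesgue measure on the circle. -/
def m : Measure Tc := AddCircle.haarAddCircle

instance : IsProbabilityMeasure m := by unfold m; infer_instance

/-- The point `e^{iθ}` of the unit circle corresponding to `θ ∈ ℝ/2πℤ`. -/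
def bd (θ : Tc) : ℂ := (AddCircle.toCircle θ : ℂ)

/-- The open unit disc. -/
abbrev uDisc : Set ℂ := Metric.ball (0 : ℂ) 1

/-- A function holomorphic on the open unit disc. -/
def HolDisc (f : ℂ → ℂ) : Prop := DifferentiableOn ℂ f uDisc

/-- `F` is the radial (a.e.) boundary function of `f`. -/
def IsBdry (f : ℂ → ℂ) (F : Tc → ℂ) : Prop :=
  ∀ᵐ θ ∂m, Tendsto (fun r : ℝ => f ((r : ℂ) * bd θ)) (nhdsWithin 1 (Set.Iio 1)) (nhds (F θ))

/-- Membership in the Hardy space `H^p` of the unit disc, `0 < p < ∞`. -/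
def MemHp (p : ℝ) (f : ℂ → ℂ) : Prop :=
  HolDisc f ∧ ∃ C : ℝ, ∀ r : ℝ, 0 ≤ r → r < 1 →
    (∫ θ : Tc, ‖f ((r : ℂ) * bd θ)‖ ^ p ∂m) ≤ C

/-- Membership in `H^∞`: bounded holomorphic functions on the disc. -/
def MemHinf (f : ℂ → ℂ) : Prop := HolDisc f ∧ ∃ C : ℝ, ∀ z ∈ uDisc, ‖f z‖ ≤ C

/-- Outer functions on the unit disc. -/
def OuterFn (f : ℂ → ℂ) : Prop :=
  HolDisc f ∧ ∃ (α : ℂ) (w : Tc → ℝ), ‖α‖ = 1 ∧ (∀ θ, 0 ≤ w θ) ∧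
    Integrable (fun θ => Real.log (w θ)) m ∧
    ∀ z ∈ uDisc,
      f z = α * Complex.exp (∫ θ : Tc, ((bd θ + z) / (bd θ - z)) * (Real.log (w θ) : ℂ) ∂m)

/-- Inner functions: `Θ` holomorphic bounded by one, with unimodular boundary values `Θs`. -/
def InnerFn (Θ : ℂ → ℂ) (Θs : Tc → ℂ) : Prop :=
  HolDisc Θ ∧ (∀ z ∈ uDisc, ‖Θ z‖ ≤ 1) ∧ IsBdry Θ Θs ∧ (∀ᵐ θ ∂m, ‖Θs θ‖ = 1)

/-- `L²(𝕋, m)`. -/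
abbrev L2 : Type := Lp ℂ 2 m

/-- The Hardy space `H²`, viewed inside `L²(𝕋)` as the functions whose negative
Fourier coefficients vanish. -/
def H2 : Set L2 := {F | ∀ n : ℤ, n < 0 → fourierCoeff (F : Tc → ℂ) n = 0}

/-- The Cauchy kernel `k_λ(z) = 1/(1 - conj(λ) z)`. -/
def ker (lam z : ℂ) : ℂ := (1 - conj lam * z)⁻¹

/-- Divergence of `Σ (1 - |λ_n|)` (for `λ_n` in the unit disc this is the negation of
the Blaschke condition). -/
def NotBlaschke (lam : ℕ → ℂ) : Prop := ¬ Summable (fun n => 1 - ‖lam n‖)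

/-- A bundle recording: a non-constant function `b` in the closed unit ball of `H^∞`
with `log(1 - |b|) ∈ L¹(𝕋)`, its Pythagorean mate `a` (outer, `a(0) > 0`,
`|a|² + |b|² = 1` a.e.), together with their boundary functions `bs`, `as'`. -/
structure BPair where
  b : ℂ → ℂ
  a : ℂ → ℂ
  bs : Tc → ℂ
  as' : Tc → ℂ
  b_hol : HolDisc b
  b_le_one : ∀ z ∈ uDisc, ‖b z‖ ≤ 1
  b_nonconst : ¬ ∃ c : ℂ, ∀ z ∈ uDisc, b z = c
  b_bdry : IsBdry b bs
  log_int : Integrable (fun θ => Real.log (1 - ‖bs θ‖)) m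
  a_outer : OuterFn a
  a_bdry : IsBdry a as'
  a0_pos : ∃ r : ℝ, 0 < r ∧ a 0 = (r : ℂ)
  pyth : ∀ᵐ θ ∂m, ‖as' θ‖ ^ 2 + ‖bs θ‖ ^ 2 = 1

/-- The defining relation of `H(b)`: `T_{conj b} F = T_{conj a} F⁺`, i.e. all nonnegative
Fourier coefficients of `conj(b)·F - conj(a)·F⁺` vanish, with `F, F⁺ ∈ H²`. -/
def HbMem (P : BPair) (F Fp : L2) : Prop :=
  F ∈ H2 ∧ Fp ∈ H2 ∧ ∀ n : ℤ, 0 ≤ n →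
    fourierCoeff (fun θ => conj (P.bs θ) * (F : Tc → ℂ) θ - conj (P.as' θ) * (Fp : Tc → ℂ) θ) n = 0

/-- The ambient Hilbert space `L² ×_2 L²` in which `H(b)` embeds isometrically via
`f ↦ (f, f⁺)`; its norm is `‖(F, F⁺)‖² = ‖F‖₂² + ‖F⁺‖₂²`, the `H(b)` norm. -/
abbrev HbP : Type := WithLp 2 (L2 × L2)

def fst2 (p : HbP) : L2 := ((WithLp.equiv 2 (L2 × L2)) p).1
def snd2 (p : HbP) : L2 := ((WithLp.equiv 2 (L2 × L2)) p).2

/-- The de Branges–Rovnyak space `H(b)`, as the set of pairs `(f, f⁺)`. -/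
def HbSet (P : BPair) : Set HbP := {p | HbMem P (fst2 p) (snd2 p)}

/-- `q` represents the element `φ · f` of `H(b)`, where `p` represents `f` and `φs` is a
boundary function: `q ∈ H(b)` and the first component of `q` is `φs` times that of `p`. -/
def MulRep (P : BPair) (φs : Tc → ℂ) (p q : HbP) : Prop :=
  q ∈ HbSet P ∧ (fst2 q : Tc → ℂ) =ᵐ[m] fun θ => φs θ * (fst2 p : Tc → ℂ) θ

/-- `Zf` is the family of elements `z^n·f`, `n ≥ 0`, of `H(b)`, where `p` represents `f`. -/
def ZFamily (P : BPair) (p : HbP) (Zf : ℕ → HbP) : Prop :=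
  ∀ n : ℕ, MulRep P (fun θ => (bd θ) ^ n) p (Zf n)

/-- `f` (represented by the pair `p`) is cyclic for `S_b`: the linear span of
`{z^n f : n ≥ 0}` is dense in `H(b)`. -/
def CyclicSb (P : BPair) (p : HbP) : Prop :=
  p ∈ HbSet P ∧ ∀ Zf : ℕ → HbP, ZFamily P p Zf →
    closure (↑(Submodule.span ℂ (Set.range Zf)) : Set HbP) = HbSet P

/-- `FK` is the family of elements `f·k_{λ_n}`, `n ≥ 0`, of `H(b)`. -/
def KFamily (P : BPair) (lam : ℕ → ℂ) (p : HbP) (FK : ℕ → HbP) : Prop :=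
  ∀ n : ℕ, MulRep P (fun θ => ker (lam n) (bd θ)) p (FK n)

/-- `C` is a bound for the norm of the shift `S_b` on `H(b)`. -/
def ShiftBound (P : BPair) (C : ℝ) : Prop :=
  0 ≤ C ∧ ∀ p q : HbP, p ∈ HbSet P → MulRep P (fun θ => bd θ) p q → ‖q‖ ≤ C * ‖p‖

/-- `N = ‖S_b‖`, the operator norm of the shift on `H(b)`. -/
def IsShiftNorm (P : BPair) (N : ℝ) : Prop :=
  ShiftBound P N ∧ ∀ C : ℝ, ShiftBound P C → N ≤ C

/-- `μ` is the Aleksandrov–Clark measure `μ_α` of `b`. -/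
def IsACMeasure (P : BPair) (α : ℂ) (μ : Measure Tc) : Prop :=
  IsFiniteMeasure μ ∧ ∀ z ∈ uDisc,
    (1 - ‖P.b z‖ ^ 2) / ‖1 - conj α * P.b z‖ ^ 2 = ∫ θ : Tc, (1 - ‖z‖ ^ 2) / ‖z - bd θ‖ ^ 2 ∂μ


open scoped Topology

lemma bd_norm (θ : Tc) : ‖bd θ‖ = 1 := Circle.norm_coe _
lemma bd_ne (θ : Tc) : bd θ ≠ 0 := by
  intro h; have := bd_norm θ; rw [h] at this; simp at this
lemma bd_cont : Continuous bd := by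
  unfold bd; exact continuous_subtype_val.comp AddCircle.continuous_toCircle
lemma bd_conj (θ : Tc) : conj (bd θ) = (bd θ)⁻¹ := by
  rw [Complex.inv_def, Complex.normSq_eq_norm_sq, bd_norm]; simp
lemma fourier_bd (n : ℤ) (θ : Tc) : fourier n θ = bd θ ^ n := by
  rw [fourier_apply, AddCircle.toCircle_zsmul]; simp [bd]
lemma bd_zpow_norm (n : ℤ) (θ : Tc) : ‖bd θ ^ n‖ = 1 := by simp [bd_norm]
lemma bd_zpow_cont (n : ℤ) : Continuous fun θ => bd θ ^ n := by
  have : (fun θ => bd θ ^ n) = fun θ => fourier n θ := by ext θ; rw [fourier_bd]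
  rw [this]; exact (fourier n).continuous
lemma fc_def (f : Tc → ℂ) (n : ℤ) : fourierCoeff f n = ∫ θ, bd θ ^ (-n) * f θ ∂m := by
  simp only [fourierCoeff, fourier_bd, smul_eq_mul]; rfl

lemma fc_congr {f g : Tc → ℂ} (h : f =ᵐ[m] g) (n : ℤ) : fourierCoeff f n = fourierCoeff g n := by
  rw [fc_def, fc_def]; apply integral_congr_ae; filter_upwards [h] with θ hθ; rw [hθ]

lemma zp_int (n : ℤ) {f : Tc → ℂ} (hf : Integrable f m) :
    Integrable (fun θ => bd θ ^ n * f θ) m := by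
  refine hf.bdd_mul (c := 1) (bd_zpow_cont n).aestronglyMeasurable ?_
  filter_upwards with θ; rw [bd_zpow_norm]

lemma fc_sub {f g : Tc → ℂ} (hf : Integrable f m) (hg : Integrable g m) (n : ℤ) :
    fourierCoeff (fun θ => f θ - g θ) n = fourierCoeff f n - fourierCoeff g n := by
  simp only [fc_def]
  rw [← integral_sub (zp_int _ hf) (zp_int _ hg)]; congr 1; ext θ; ring
lemma fc_add {f g : Tc → ℂ} (hf : Integrable f m) (hg : Integrable g m) (n : ℤ) :
    fourierCoeff (fun θ => f θ + g θ) n = fourierCoeff f n + fourierCoeff g n := by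
  simp only [fc_def]
  rw [← integral_add (zp_int _ hf) (zp_int _ hg)]; congr 1; ext θ; ring
lemma fc_smul (c : ℂ) (f : Tc → ℂ) (n : ℤ) :
    fourierCoeff (fun θ => c * f θ) n = c * fourierCoeff f n := by
  simp only [fc_def]
  rw [← integral_const_mul]; congr 1; ext θ; ring
lemma fc_conj (f : Tc → ℂ) (n : ℤ) :
    fourierCoeff (fun θ => conj (f θ)) n = conj (fourierCoeff f (-n)) := by
  simp only [fc_def]
  rw [← integral_conj]; congr 1; ext θ
  simp only [map_mul, map_zpow₀, bd_conj, inv_zpow, neg_neg, zpow_neg]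
lemma fc_shift (f : Tc → ℂ) (k n : ℤ) :
    fourierCoeff (fun θ => bd θ ^ k * f θ) n = fourierCoeff f (n - k) := by
  simp only [fc_def]
  congr 1; ext θ; rw [← mul_assoc, ← zpow_add₀ (bd_ne θ)]; congr 2; ring

lemma fc_le (f : Tc → ℂ) (n : ℤ) : ‖fourierCoeff f n‖ ≤ ∫ θ, ‖f θ‖ ∂m := by
  rw [fc_def]; refine (norm_integral_le_integral_norm _).trans (le_of_eq ?_)
  congr 1; ext θ; rw [norm_mul, bd_zpow_norm, one_mul]

/-- L2 (semi)norm as a real number -/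
def n2 (f : Tc → ℂ) : ℝ := (eLpNorm f 2 m).toReal

lemma n2_nonneg (f : Tc → ℂ) : 0 ≤ n2 f := ENNReal.toReal_nonneg

lemma n2_sq {f : Tc → ℂ} (hf : MemLp f 2 m) : n2 f ^ 2 = ∫ θ, ‖f θ‖ ^ 2 ∂m := by
  unfold n2
  rw [hf.eLpNorm_eq_integral_rpow_norm (by norm_num) (by norm_num)]
  have h0 : 0 ≤ ∫ θ, ‖f θ‖ ^ 2 ∂m := integral_nonneg fun θ => by positivity
  simp only [ENNReal.toReal_ofNat, Real.rpow_ofNat]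
  rw [ENNReal.toReal_ofReal (by positivity), ← Real.rpow_natCast, ← Real.rpow_mul h0]; simp

lemma sq_int {f : Tc → ℂ} (hf : MemLp f 2 m) : Integrable (fun θ => ‖f θ‖ ^ 2) m := by
  simpa using hf.integrable_norm_rpow (by norm_num) (by norm_num)

lemma n2_add {f g : Tc → ℂ} (hf : MemLp f 2 m) (hg : MemLp g 2 m) :
    n2 (fun θ => f θ + g θ) ≤ n2 f + n2 g := by
  unfold n2
  rw [← ENNReal.toReal_add hf.2.ne hg.2.ne]
  refine ENNReal.toReal_mono (by simp [hf.2.ne, hg.2.ne]) ?_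
  exact eLpNorm_add_le hf.1 hg.1 (by norm_num)

lemma n2_smul (c : ℂ) (f : Tc → ℂ) : n2 (fun θ => c * f θ) = ‖c‖ * n2 f := by
  unfold n2
  have : (fun θ => c * f θ) = c • f := by ext; simp
  rw [this, eLpNorm_const_smul]; simp

lemma n2_mono {f g : Tc → ℂ} (hg : MemLp g 2 m) (h : ∀ᵐ θ ∂m, ‖f θ‖ ≤ ‖g θ‖) : n2 f ≤ n2 g := by
  unfold n2
  exact ENNReal.toReal_mono hg.2.ne (eLpNorm_mono_ae h)

lemma mul_int {f g : Tc → ℂ} (hf : MemLp f 2 m) (hg : MemLp g 2 m) :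
    Integrable (fun θ => f θ * g θ) m := hf.integrable_mul hg

lemma n2_cs {f g : Tc → ℂ} (hf : MemLp f 2 m) (hg : MemLp g 2 m) :
    ∫ θ, ‖f θ * g θ‖ ∂m ≤ n2 f * n2 g := by
  have h := eLpNorm_smul_le_mul_eLpNorm (p := 2) (q := 2) (r := 1) hg.1 hf.1
  have e : ∫ θ, ‖f θ * g θ‖ ∂m = (eLpNorm (f • g) 1 m).toReal := by
    rw [eLpNorm_one_eq_lintegral_enorm, show (∫ θ, ‖f θ * g θ‖ ∂m) = ∫ θ, ‖(f * g) θ‖ ∂m from rfl,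
      integral_norm_eq_lintegral_enorm (hf.1.mul hg.1)]; rfl
  rw [e]; unfold n2; rw [← ENNReal.toReal_mul]
  exact ENNReal.toReal_mono (ENNReal.mul_ne_top hf.2.ne hg.2.ne) h

lemma n2_cs' {f g : Tc → ℂ} (hf : MemLp f 2 m) (hg : MemLp g 2 m) (n : ℤ) :
    ‖fourierCoeff (fun θ => f θ * g θ) n‖ ≤ n2 f * n2 g := (fc_le _ _).trans (n2_cs hf hg)

lemma n1_le_n2 {f : Tc → ℂ} (hf : MemLp f 2 m) : ∫ θ, ‖f θ‖ ∂m ≤ n2 f := by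
  have h1 : MemLp (fun _ : Tc => (1:ℂ)) 2 m := memLp_const 1
  have := n2_cs hf h1
  have e : n2 (fun _ : Tc => (1:ℂ)) = 1 := by
    have := n2_sq h1
    simp at this
    have h0 := n2_nonneg (fun _ : Tc => (1:ℂ))
    rcases this with h | h <;> linarith
  simpa [e] using this

abbrev haarT : Measure Tc := AddCircle.haarAddCircle (T := 2 * Real.pi)

lemma parseval_h {f : Tc → ℂ} (hf : MemLp f 2 haarT) :
    HasSum (fun n : ℤ => ‖fourierCoeff f n‖ ^ 2) (∫ θ, ‖f θ‖ ^ 2 ∂haarT) := by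
  have := hasSum_sq_fourierCoeff (T := 2 * Real.pi) (hf.toLp f)
  have e : ∀ n, fourierCoeff (hf.toLp f : Tc → ℂ) n = fourierCoeff f n := fun n =>
    fc_congr hf.coeFn_toLp n
  simp only [e] at this
  convert this using 1
  apply integral_congr_ae
  filter_upwards [hf.coeFn_toLp] with θ hθ
  rw [← hθ]

/-- Parseval -/
lemma parseval {f : Tc → ℂ} (hf : MemLp f 2 m) :
    HasSum (fun n : ℤ => ‖fourierCoeff f n‖ ^ 2) (n2 f ^ 2) := by
  rw [n2_sq hf]; exact parseval_h hf

lemma conj_memLp {f : Tc → ℂ} {p} (hf : MemLp f p m) : MemLp (fun θ => conj (f θ)) p m :=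
  hf.of_le (Complex.continuous_conj.comp_aestronglyMeasurable hf.1) (by simp)

lemma bdd_memLp {f g : Tc → ℂ} {p} {C : ℝ} (hg : MemLp g p m) (hf : AEStronglyMeasurable f m)
    (h : ∀ᵐ θ ∂m, ‖f θ‖ ≤ C) : MemLp (fun θ => f θ * g θ) p m := by
  refine MemLp.of_le_mul hg (c := C) (hf.mul hg.1) ?_
  filter_upwards [h] with θ h
  rw [norm_mul]; gcongr

lemma bdd_memLp' {f : Tc → ℂ} {p} {C : ℝ} (hf : AEStronglyMeasurable f m)
    (h : ∀ᵐ θ ∂m, ‖f θ‖ ≤ C) : MemLp f p m := MemLp.of_bound hf C h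

lemma orth_int_h {f g : Tc → ℂ} (hf : MemLp f 2 haarT) (hg : MemLp g 2 haarT)
    (h : ∀ n : ℤ, fourierCoeff f n = 0 ∨ fourierCoeff g n = 0) :
    ∫ θ, f θ * conj (g θ) ∂haarT = 0 := by
  have := (fourierBasis (T := 2 * Real.pi)).hasSum_inner_mul_inner (hg.toLp g) (hf.toLp f)
  have e : (fun n : ℤ => inner ℂ (hg.toLp g) (fourierBasis (T := 2 * Real.pi) n) *
      inner ℂ (fourierBasis (T := 2 * Real.pi) n) (hf.toLp f)) = fun _ => 0 := by
    ext n
    have h1 : ∀ k : Lp ℂ 2 (AddCircle.haarAddCircle (T := 2 * Real.pi)),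
        inner ℂ (fourierBasis (T := 2 * Real.pi) n) k = fourierCoeff (k : Tc → ℂ) n := by
      intro k; rw [← HilbertBasis.repr_apply_apply, fourierBasis_repr]
    rw [← inner_conj_symm (hg.toLp g), h1, h1]
    have e1 := fc_congr hf.coeFn_toLp n
    have e2 := fc_congr hg.coeFn_toLp n
    rcases h n with h | h
    · rw [h] at e1; rw [e1]; simp
    · rw [h] at e2; rw [e2]; simp
  rw [e] at this
  have h0 := this.unique hasSum_zero
  rw [MeasureTheory.L2.inner_def] at h0
  rw [← h0]
  apply integral_congr_ae
  filter_upwards [hf.coeFn_toLp, hg.coeFn_toLp] with θ h1 h2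
  rw [RCLike.inner_apply, h1, h2]

/-- Functions with complementary Fourier supports are orthogonal. -/
lemma orth_int {f g : Tc → ℂ} (hf : MemLp f 2 m) (hg : MemLp g 2 m)
    (h : ∀ n : ℤ, fourierCoeff f n = 0 ∨ fourierCoeff g n = 0) :
    ∫ θ, f θ * conj (g θ) ∂m = 0 := orth_int_h hf hg h

/-- Riesz-Fischer -/
lemma riesz_fischer_h (c : ℤ → ℂ) (hc : Summable fun n => ‖c n‖ ^ 2) :
    ∃ f : Tc → ℂ, MemLp f 2 haarT ∧ ∀ n, fourierCoeff f n = c n := by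
  have hm : Memℓp c 2 := by
    rw [memℓp_gen_iff (by norm_num)]; simpa using hc
  let x : lp (fun _ : ℤ => ℂ) 2 := ⟨c, hm⟩
  let F := (fourierBasis (T := 2 * Real.pi)).repr.symm x
  refine ⟨F, Lp.memLp F, fun n => ?_⟩
  rw [← fourierBasis_repr]; simp [F, x]

lemma riesz_fischer (c : ℤ → ℂ) (hc : Summable fun n => ‖c n‖ ^ 2) :
    ∃ f : Tc → ℂ, MemLp f 2 m ∧ ∀ n, fourierCoeff f n = c n := riesz_fischer_h c hc

lemma fc_zero_ae {f : Tc → ℂ} (hf : MemLp f 2 m) (h : ∀ n : ℤ, fourierCoeff f n = 0) :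
    f =ᵐ[m] 0 := by
  have := (parseval hf).unique (by simp only [h, norm_zero]; norm_num; exact hasSum_zero)
  have h2 : n2 f = 0 := by simpa using this
  unfold n2 at h2
  rw [ENNReal.toReal_eq_zero_iff] at h2
  rcases h2 with h2 | h2
  · rwa [eLpNorm_eq_zero_iff hf.1 (by norm_num)] at h2
  · exact absurd h2 hf.2.ne

/-- radii increasing to one -/
def rr (k : ℕ) : ℝ := 1 - 1 / ((k : ℝ) + 2)

lemma rr_half (k : ℕ) : 1 / 2 ≤ rr k := by
  unfold rr
  have : 1 / ((k : ℝ) + 2) ≤ 1 / 2 := by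
    apply one_div_le_one_div_of_le <;> linarith [Nat.cast_nonneg (α := ℝ) k]
  linarith
lemma rr_nonneg (k : ℕ) : 0 ≤ rr k := by linarith [rr_half k]
lemma rr_lt (k : ℕ) : rr k < 1 := by
  unfold rr
  have : 0 < 1 / ((k : ℝ) + 2) := by positivity
  linarith
lemma rr_zero : rr 0 = 1 / 2 := by unfold rr; norm_num
lemma rr_tendsto : Tendsto rr atTop (𝓝 1) := by
  unfold rr
  have h : Tendsto (fun k : ℕ => 1 / ((k : ℝ) + 2)) atTop (𝓝 0) := by
    have := tendsto_one_div_add_atTop_nhds_zero_nat (𝕜 := ℝ)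
    have h2 := (tendsto_add_atTop_iff_nat 1).2 this
    refine h2.congr fun k => ?_
    push_cast; ring_nf
  simpa using h.const_sub 1
lemma rr_tendsto' : Tendsto rr atTop (𝓝[<] 1) :=
  tendsto_nhdsWithin_iff.2 ⟨rr_tendsto, Eventually.of_forall fun k => rr_lt k⟩

/-- dilations -/
def dil (e : ℂ → ℂ) (k : ℕ) (θ : Tc) : ℂ := e ((rr k : ℂ) * bd θ)

lemma rb_norm (k : ℕ) (θ : Tc) : ‖(rr k : ℂ) * bd θ‖ = rr k := by
  rw [norm_mul, bd_norm, mul_one, Complex.norm_real, Real.norm_of_nonneg (rr_nonneg k)]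
lemma rb_mem (k : ℕ) (θ : Tc) : (rr k : ℂ) * bd θ ∈ uDisc := by
  rw [mem_ball_zero_iff, rb_norm]; exact rr_lt k

lemma dil_cont {e : ℂ → ℂ} (he : HolDisc e) (k : ℕ) : Continuous (dil e k) := by
  have : ContinuousOn e uDisc := he.continuousOn
  exact this.comp_continuous (continuous_const.mul bd_cont) (rb_mem k)

lemma cont_memLp {g : Tc → ℂ} (hg : Continuous g) (p) : MemLp g p m := by
  obtain ⟨C, hC⟩ := isCompact_univ.exists_bound_of_continuousOn (f := g) hg.continuousOn
  exact MemLp.of_bound hg.aestronglyMeasurable C (by filter_upwards with θ using hC θ trivial)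

lemma dil_memLp {e : ℂ → ℂ} (he : HolDisc e) (k : ℕ) (p) : MemLp (dil e k) p m :=
  cont_memLp (dil_cont he k) p

lemma memLp_int {g : Tc → ℂ} (hg : MemLp g 2 m) : Integrable g m := hg.integrable (by norm_num)

/-- Taylor coefficients, indexed by integers -/
def tc (e : ℂ → ℂ) (n : ℤ) : ℂ :=
  if 0 ≤ n then ((n.toNat).factorial : ℂ)⁻¹ * iteratedDeriv n.toNat e 0 else 0

lemma tc_neg (e : ℂ → ℂ) {n : ℤ} (h : n < 0) : tc e n = 0 := by
  unfold tc; rw [if_neg (by omega)]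

lemma hol_ps {e : ℂ → ℂ} (he : HolDisc e) {z : ℂ} (hz : z ∈ uDisc) :
    HasSum (fun n : ℕ => tc e n * z ^ n) (e z) := by
  have := Complex.hasSum_taylorSeries_on_ball (f := e) (c := 0) (r := 1) he hz
  refine this.congr_fun ?_ |> fun h => h
  intro n
  simp [tc]; ring

/-- Fourier coefficients of dilated power series -/
lemma fc_ps {e : ℂ → ℂ} {c : ℕ → ℂ} (h : ∀ z ∈ uDisc, HasSum (fun n : ℕ => c n * z ^ n) (e z))
    (k : ℕ) (n : ℤ) :
    fourierCoeff (dil e k) n = if 0 ≤ n then c n.toNat * (rr k : ℂ) ^ n.toNat else 0 := by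
  rw [fc_def]
  have hs : Summable fun n : ℕ => ‖c n * (rr k : ℂ) ^ n‖ := by
    have := (h (rr k : ℂ) (by
      rw [mem_ball_zero_iff, Complex.norm_real, Real.norm_of_nonneg (rr_nonneg k)]
      exact rr_lt k)).summable
    exact this.norm
  have hI : HasSum (fun j : ℕ => ∫ θ, bd θ ^ (-n) * (c j * ((rr k : ℂ) * bd θ) ^ j) ∂m)
      (∫ θ, bd θ ^ (-n) * dil e k θ ∂m) := by
    refine hasSum_integral_of_dominated_convergence (fun j _ => ‖c j * (rr k : ℂ) ^ j‖) ?_ ?_ ?_ ?_ ?_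
    · intro j
      exact ((bd_zpow_cont _).mul (continuous_const.mul
        ((continuous_const.mul bd_cont).pow _))).aestronglyMeasurable
    · intro j; filter_upwards with θ
      rw [norm_mul, bd_zpow_norm, one_mul, mul_pow, norm_mul, norm_mul, norm_mul, norm_pow (bd θ),
        bd_norm]; simp
    · filter_upwards with θ using hs
    · exact integrable_const _
    · filter_upwards with θ
      exact (h _ (rb_mem k θ)).mul_left _
  have hterm : ∀ j : ℕ, ∫ θ, bd θ ^ (-n) * (c j * ((rr k : ℂ) * bd θ) ^ j) ∂m =
      if (j : ℤ) = n then c j * (rr k : ℂ) ^ j else 0 := by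
    intro j
    have e1 : ∀ θ, bd θ ^ (-n) * (c j * ((rr k : ℂ) * bd θ) ^ j) =
        (c j * (rr k : ℂ) ^ j) * bd θ ^ ((j : ℤ) - n) := by
      intro θ
      rw [sub_eq_add_neg, zpow_add₀ (bd_ne θ), zpow_natCast]; ring
    simp only [e1]
    rw [integral_const_mul]
    have e2 : ∫ θ, bd θ ^ ((j : ℤ) - n) ∂m = if (j : ℤ) = n then 1 else 0 := by
      have := fc_shift (fun _ => 1) ((j : ℤ) - n) 0
      rw [fc_def, fc_def] at this
      simp only [neg_zero, zpow_zero, one_mul, mul_one] at this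
      split_ifs with hj
      · subst hj; simp
      · have hi : ∀ q : ℤ, q ≠ 0 → ∫ θ, bd θ ^ q ∂m = 0 := by
          intro q hq
          have := integral_eq_zero_of_add_right_eq_neg (μ := AddCircle.haarAddCircle (T := 2 * Real.pi)) (fourier_add_half_inv_index hq Fact.out)
          have e3 : (fun θ : Tc => bd θ ^ q) = fun θ => fourier q θ := by
            ext θ; rw [fourier_bd]
          rw [e3]; exact this
        exact hi _ (by omega)
    rw [e2]; split_ifs <;> simp
  simp only [hterm] at hI
  split_ifs with hn
  · have : HasSum (fun j : ℕ => if (j : ℤ) = n then c j * (rr k : ℂ) ^ j else 0)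
        (c n.toNat * (rr k : ℂ) ^ n.toNat) := by
      convert hasSum_single (f := fun j : ℕ => if (j : ℤ) = n then c j * (rr k : ℂ) ^ j else 0)
        n.toNat ?_ using 1
      · simp [hn]
      · intro j hj; rw [if_neg]; omega
    exact hI.unique this
  · have : (fun j : ℕ => if (j : ℤ) = n then c j * (rr k : ℂ) ^ j else 0) = fun _ => 0 := by
      ext j; rw [if_neg]; omega
    rw [this] at hI
    exact hI.unique hasSum_zero

lemma ps_hol {e : ℂ → ℂ} {c : ℕ → ℂ} (h : ∀ z ∈ uDisc, HasSum (fun n : ℕ => c n * z ^ n) (e z)) :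
    HolDisc e := by
  have key : ∀ k : ℕ, DifferentiableOn ℂ e (ball 0 (rr k)) := by
    intro k
    have hs : Summable fun n : ℕ => ‖c n * (rr k : ℂ) ^ n‖ := by
      have := (h (rr k : ℂ) (by
        rw [mem_ball_zero_iff, Complex.norm_real, Real.norm_of_nonneg (rr_nonneg k)]
        exact rr_lt k)).summable
      exact this.norm
    have := differentiableOn_tsum_of_summable_norm (F := fun (n : ℕ) z => c n * z ^ n)
      (U := ball 0 (rr k)) hs (fun n => by fun_prop) isOpen_ball ?_
    · refine this.congr fun z hz => ?_
      exact ((h z (ball_subset_ball (rr_lt k).le hz)).tsum_eq).symm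
    · intro n z hz
      rw [norm_mul, norm_mul, norm_pow, norm_pow, Complex.norm_real, Real.norm_of_nonneg (rr_nonneg k)]
      rw [mem_ball_zero_iff] at hz
      gcongr
  intro z hz
  rw [mem_ball_zero_iff] at hz
  obtain ⟨k, hk⟩ := (rr_tendsto.eventually (lt_mem_nhds hz)).exists
  have := (key k).differentiableAt (isOpen_ball.mem_nhds (show z ∈ ball 0 (rr k) by simpa using hk))
  exact this.differentiableWithinAt

lemma fc_dil {e : ℂ → ℂ} (he : HolDisc e) (k : ℕ) (n : ℤ) :
    fourierCoeff (dil e k) n = tc e n * (rr k : ℂ) ^ n.natAbs := by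
  rw [fc_ps (c := fun n => tc e n) (fun z hz => hol_ps he hz)]
  split_ifs with hn
  · have h1 : ((n.toNat : ℕ) : ℤ) = n := Int.toNat_of_nonneg hn
    have h2 : n.toNat = n.natAbs := by omega
    rw [h1, h2]
  · rw [tc_neg e (by omega)]; simp

lemma ps_uniq {e : ℂ → ℂ} {c : ℕ → ℂ} (h : ∀ z ∈ uDisc, HasSum (fun n : ℕ => c n * z ^ n) (e z))
    (n : ℕ) : tc e n = c n := by
  have h1 := fc_dil (ps_hol h) 0 n
  rw [fc_ps h] at h1
  simp at h1
  have : rr 0 ≠ 0 := by rw [rr_zero]; norm_num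
  simp [this] at h1
  exact h1.symm

lemma eq_of_tc {e g : ℂ → ℂ} (he : HolDisc e) (hg : HolDisc g) (h : ∀ n : ℕ, tc e n = tc g n)
    {z : ℂ} (hz : z ∈ uDisc) : e z = g z := by
  have h1 := hol_ps he hz
  simp only [h] at h1
  exact h1.unique (hol_ps hg hz)

lemma tc_zero (e : ℂ → ℂ) : tc e 0 = e 0 := by simp [tc]

lemma tc_add {e g : ℂ → ℂ} (he : HolDisc e) (hg : HolDisc g) (n : ℕ) :
    tc (fun z => e z + g z) n = tc e n + tc g n := by
  apply ps_uniq (c := fun n => tc e n + tc g n)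
  intro z hz
  simpa [add_mul] using (hol_ps he hz).add (hol_ps hg hz)

lemma tc_smul {e : ℂ → ℂ} (he : HolDisc e) (c : ℂ) (n : ℕ) :
    tc (fun z => c * e z) n = c * tc e n := by
  apply ps_uniq (c := fun n => c * tc e n)
  intro z hz
  simpa [mul_assoc] using (hol_ps he hz).mul_left c

lemma n2_congr {f g : Tc → ℂ} (h : f =ᵐ[m] g) : n2 f = n2 g := by
  unfold n2; rw [eLpNorm_congr_ae h]

/-- `E` is the L2 boundary function of `e` -/
def Bd2 (e : ℂ → ℂ) (E : Tc → ℂ) : Prop :=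
  HolDisc e ∧ MemLp E 2 m ∧ Tendsto (fun k => n2 (fun θ => dil e k θ - E θ)) atTop (𝓝 0)
/-- `E` is the L1 boundary function of `e` -/
def Bd1 (e : ℂ → ℂ) (E : Tc → ℂ) : Prop :=
  HolDisc e ∧ Integrable E m ∧ Tendsto (fun k => ∫ θ, ‖dil e k θ - E θ‖ ∂m) atTop (𝓝 0)

lemma Bd2.bd1 {e E} (h : Bd2 e E) : Bd1 e E := by
  refine ⟨h.1, memLp_int h.2.1, ?_⟩
  refine squeeze_zero (fun k => integral_nonneg fun θ => norm_nonneg _) (fun k => ?_) h.2.2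
  exact n1_le_n2 ((dil_memLp h.1 k 2).sub h.2.1)

lemma Bd1.fc {e E} (h : Bd1 e E) (n : ℤ) : fourierCoeff E n = tc e n := by
  have h1 : Tendsto (fun k => fourierCoeff (dil e k) n) atTop (𝓝 (fourierCoeff E n)) := by
    rw [tendsto_iff_norm_sub_tendsto_zero]
    refine squeeze_zero (fun k => norm_nonneg _) (fun k => ?_) h.2.2
    rw [← fc_sub (memLp_int (dil_memLp h.1 k 2)) h.2.1]
    exact fc_le _ _
  have h2 : Tendsto (fun k => fourierCoeff (dil e k) n) atTop (𝓝 (tc e n)) := by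
    simp only [fc_dil h.1]
    have : Tendsto (fun k => (rr k : ℂ)) atTop (𝓝 1) :=
      (Complex.continuous_ofReal.tendsto 1).comp rr_tendsto
    simpa using (this.pow n.natAbs).const_mul (tc e n)
  exact tendsto_nhds_unique h1 h2

lemma Bd2.fc {e E} (h : Bd2 e E) (n : ℤ) : fourierCoeff E n = tc e n := h.bd1.fc n

lemma bd2_of_fc {e : ℂ → ℂ} {E : Tc → ℂ} (he : HolDisc e) (hE : MemLp E 2 m)
    (h : ∀ n : ℤ, fourierCoeff E n = tc e n) : Bd2 e E := by
  refine ⟨he, hE, ?_⟩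
  have hd : ∀ k, MemLp (fun θ => dil e k θ - E θ) 2 m := fun k => (dil_memLp he k 2).sub hE
  have key : Tendsto (fun k => n2 (fun θ => dil e k θ - E θ) ^ 2) atTop (𝓝 0) := by
    have e1 : ∀ k, n2 (fun θ => dil e k θ - E θ) ^ 2 =
        ∑' n : ℤ, ‖tc e n * (rr k : ℂ) ^ n.natAbs - tc e n‖ ^ 2 := by
      intro k
      rw [← (parseval (hd k)).tsum_eq]
      congr 1; ext n
      rw [fc_sub (memLp_int (dil_memLp he k 2)) (memLp_int hE), fc_dil he, h]
    simp only [e1]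
    have e2 : (0 : ℝ) = ∑' n : ℤ, (0 : ℝ) := by simp
    rw [e2]
    have hs := (parseval hE).summable
    simp only [h] at hs
    refine tendsto_tsum_of_dominated_convergence (bound := fun n => ‖tc e n‖ ^ 2) hs ?_ ?_
    · intro n
      have : Tendsto (fun k => (rr k : ℂ)) atTop (𝓝 1) :=
        (Complex.continuous_ofReal.tendsto 1).comp rr_tendsto
      have h3 := (((this.pow n.natAbs).const_mul (tc e n)).sub_const (tc e n)).norm.pow 2
      simpa using h3
    · filter_upwards with k n
      rw [Real.norm_of_nonneg (by positivity)]
      have e4 : tc e n * (rr k : ℂ) ^ n.natAbs - tc e n = tc e n * ((rr k ^ n.natAbs - 1 : ℝ) : ℂ) := by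
        push_cast; ring
      rw [e4, norm_mul, Complex.norm_real, Real.norm_eq_abs]
      have h5 : rr k ^ n.natAbs ≤ 1 := pow_le_one₀ (rr_nonneg k) (rr_lt k).le
      have h6 : 0 ≤ rr k ^ n.natAbs := pow_nonneg (rr_nonneg k) _
      have h7 : |rr k ^ n.natAbs - 1| ≤ 1 := abs_le.2 ⟨by linarith, by linarith⟩
      have h8 : ‖tc e n‖ * |rr k ^ n.natAbs - 1| ≤ ‖tc e n‖ * 1 := by gcongr
      rw [mul_one] at h8
      gcongr
  have := (Real.continuous_sqrt.tendsto 0).comp key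
  simp only [Real.sqrt_zero] at this
  refine this.congr fun k => ?_
  simp [Real.sqrt_sq (n2_nonneg _)]

lemma bd2_exists {e : ℂ → ℂ} (he : HolDisc e) {K : ℝ} (hK : ∀ k, n2 (dil e k) ≤ K) :
    ∃ E, Bd2 e E ∧ n2 E ≤ K := by
  have hK0 : 0 ≤ K := (n2_nonneg _).trans (hK 0)
  have hfin : ∀ s : Finset ℤ, ∑ n ∈ s, ‖tc e n‖ ^ 2 ≤ K ^ 2 := by
    intro s
    have h1 : ∀ k, ∑ n ∈ s, ‖tc e n * (rr k : ℂ) ^ n.natAbs‖ ^ 2 ≤ K ^ 2 := by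
      intro k
      have hp := parseval (dil_memLp he k 2)
      have := hp.summable.sum_le_tsum s (fun n _ => by positivity)
      rw [hp.tsum_eq] at this
      simp only [fc_dil he] at this
      refine this.trans ?_
      have := hK k
      have := n2_nonneg (dil e k)
      gcongr
    have h2 : Tendsto (fun k => ∑ n ∈ s, ‖tc e n * (rr k : ℂ) ^ n.natAbs‖ ^ 2) atTop
        (𝓝 (∑ n ∈ s, ‖tc e n‖ ^ 2)) := by
      refine tendsto_finsetSum _ fun n _ => ?_
      have : Tendsto (fun k => (rr k : ℂ)) atTop (𝓝 1) :=
        (Complex.continuous_ofReal.tendsto 1).comp rr_tendsto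
      simpa using ((this.pow n.natAbs).const_mul (tc e n)).norm.pow 2
    exact le_of_tendsto' h2 h1
  have hs : Summable fun n => ‖tc e n‖ ^ 2 := summable_of_sum_le (fun n => by positivity) hfin
  obtain ⟨E, hE, hc⟩ := riesz_fischer _ hs
  refine ⟨E, bd2_of_fc he hE hc, ?_⟩
  have h3 := (parseval hE).tsum_eq
  simp only [hc] at h3
  have h4 : n2 E ^ 2 ≤ K ^ 2 := by
    rw [← h3]; exact hs.tsum_le_of_sum_le hfin
  exact abs_le_of_sq_le_sq' h4 hK0 |>.2

lemma hol_mul {e g : ℂ → ℂ} (he : HolDisc e) (hg : HolDisc g) : HolDisc (fun z => e z * g z) :=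
  DifferentiableOn.mul he hg
lemma hol_add {e g : ℂ → ℂ} (he : HolDisc e) (hg : HolDisc g) : HolDisc (fun z => e z + g z) :=
  DifferentiableOn.add he hg

lemma n2_conv_bdd {e E} (h : Bd2 e E) (k : ℕ) :
    n2 (dil e k) ≤ n2 (fun θ => dil e k θ - E θ) + n2 E := by
  have := n2_add (f := fun θ => dil e k θ - E θ) ((dil_memLp h.1 k 2).sub h.2.1) h.2.1
  simpa using this

lemma bd1_mul {e g E G} (he : Bd2 e E) (hg : Bd2 g G) :
    Bd1 (fun z => e z * g z) (fun θ => E θ * G θ) := by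
  refine ⟨hol_mul he.1 hg.1, mul_int he.2.1 hg.2.1, ?_⟩
  have hb : Tendsto (fun k => n2 (fun θ => dil e k θ - E θ) * (n2 (fun θ => dil g k θ - G θ) + n2 G)
      + n2 E * n2 (fun θ => dil g k θ - G θ)) atTop (𝓝 0) := by
    have := (he.2.2.mul (hg.2.2.add_const (n2 G))).add (hg.2.2.const_mul (n2 E))
    simpa using this
  refine squeeze_zero (fun k => integral_nonneg fun θ => norm_nonneg _) (fun k => ?_) hb
  have hA := ((dil_memLp he.1 k 2).sub he.2.1)
  have hB := ((dil_memLp hg.1 k 2).sub hg.2.1)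
  have c1 := n2_cs hA (dil_memLp hg.1 k 2)
  have c2 := n2_cs he.2.1 hB
  have i1 := (mul_int hA (dil_memLp hg.1 k 2)).norm
  have i2 := (mul_int he.2.1 hB).norm
  calc _ ≤ ∫ θ, (‖(dil e k - E) θ * dil g k θ‖ + ‖E θ * (dil g k - G) θ‖) ∂m := by
        apply integral_mono_of_nonneg (ae_of_all _ fun θ => norm_nonneg _) (i1.add i2)
        filter_upwards with θ
        refine (le_of_eq ?_).trans (norm_add_le _ _)
        congr 1
        simp only [dil, Pi.sub_apply]; ring
    _ = _ := integral_add i1 i2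
    _ ≤ _ := by
        have c3 := mul_le_mul_of_nonneg_left (n2_conv_bdd hg k) (n2_nonneg (fun θ => dil e k θ - E θ))
        exact add_le_add (c1.trans c3) c2

lemma bd1_bd2 {e E} (h : Bd1 e E) (hE : MemLp E 2 m) : Bd2 e E := bd2_of_fc h.1 hE h.fc

lemma Bd2.congr {e E E'} (h : Bd2 e E) (hE : E =ᵐ[m] E') : Bd2 e E' :=
  bd2_of_fc h.1 (h.2.1.ae_eq hE) fun n => by rw [← fc_congr hE, h.fc]

lemma Bd2.add {e g E G} (he : Bd2 e E) (hg : Bd2 g G) :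
    Bd2 (fun z => e z + g z) (fun θ => E θ + G θ) := by
  refine bd2_of_fc (hol_add he.1 hg.1) (he.2.1.add hg.2.1) fun n => ?_
  rw [fc_add (memLp_int he.2.1) (memLp_int hg.2.1), he.fc, hg.fc]
  by_cases hn : 0 ≤ n
  · lift n to ℕ using hn
    rw [tc_add he.1 hg.1]
  · simp [tc_neg _ (not_le.1 hn)]

lemma bdd_mul {e g E G} {C : ℝ} (he : Bd2 e E) (hC : ∀ᵐ θ ∂m, ‖E θ‖ ≤ C) (hg : Bd2 g G) :
    Bd2 (fun z => e z * g z) (fun θ => E θ * G θ) :=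
  bd1_bd2 (bd1_mul he hg) (bdd_memLp hg.2.1 he.2.1.1 hC)

/-- a.e. convergent subsequence of a given subsequence -/
lemma sub_ae {φ : ℕ → Tc → ℂ} {E : Tc → ℂ} (hφ : ∀ k, Integrable (φ k) m) (hE : Integrable E m)
    (h : Tendsto (fun k => ∫ θ, ‖φ k θ - E θ‖ ∂m) atTop (𝓝 0)) :
    ∃ ns : ℕ → ℕ, StrictMono ns ∧ ∀ᵐ θ ∂m, Tendsto (fun i => φ (ns i) θ) atTop (𝓝 (E θ)) := by
  have h1 : TendstoInMeasure m φ atTop E := by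
    refine tendstoInMeasure_of_tendsto_eLpNorm (p := 1) one_ne_zero (fun k => (hφ k).1) hE.1 ?_
    have : ∀ k, eLpNorm (φ k - E) 1 m = ENNReal.ofReal (∫ θ, ‖φ k θ - E θ‖ ∂m) := by
      intro k
      rw [eLpNorm_one_eq_lintegral_enorm, ← ofReal_integral_norm_eq_lintegral_enorm ((hφ k).sub hE)]
      rfl
    simp only [this]
    simpa using ENNReal.tendsto_ofReal h
  exact h1.exists_seq_tendsto_ae

lemma sub_ae' {φ : ℕ → Tc → ℂ} {E : Tc → ℂ} (hφ : ∀ k, Integrable (φ k) m) (hE : Integrable E m)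
    (h : Tendsto (fun k => ∫ θ, ‖φ k θ - E θ‖ ∂m) atTop (𝓝 0)) {ms : ℕ → ℕ} (hm : StrictMono ms) :
    ∃ ns : ℕ → ℕ, StrictMono ns ∧
      ∀ᵐ θ ∂m, Tendsto (fun i => φ (ms (ns i)) θ) atTop (𝓝 (E θ)) :=
  sub_ae (φ := fun k => φ (ms k)) (fun k => hφ _) hE (h.comp hm.tendsto_atTop)

lemma Bd1.sub {e E} (h : Bd1 e E) {ms : ℕ → ℕ} (hm : StrictMono ms) :
    ∃ ns : ℕ → ℕ, StrictMono ns ∧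
      ∀ᵐ θ ∂m, Tendsto (fun i => dil e (ms (ns i)) θ) atTop (𝓝 (E θ)) :=
  sub_ae' (fun k => memLp_int (dil_memLp h.1 k 2)) h.2.1 h.2.2 hm

lemma IsBdry.dil {e E} (h : IsBdry e E) :
    ∀ᵐ θ ∂m, Tendsto (fun k => dil e k θ) atTop (𝓝 (E θ)) := by
  filter_upwards [h] with θ hθ
  exact hθ.comp rr_tendsto'

lemma bd2_of_bdry {e E} {C : ℝ} (he : HolDisc e) (hC : ∀ z ∈ uDisc, ‖e z‖ ≤ C) (h : IsBdry e E) :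
    Bd2 e E ∧ ∀ᵐ θ ∂m, ‖E θ‖ ≤ C := by
  have hd := h.dil
  have hb : ∀ᵐ θ ∂m, ‖E θ‖ ≤ C := by
    filter_upwards [hd] with θ hθ
    exact le_of_tendsto' hθ.norm fun k => hC _ (rb_mem k θ)
  have hm : AEStronglyMeasurable E m :=
    aestronglyMeasurable_of_tendsto_ae atTop (fun k => (dil_cont he k).aestronglyMeasurable) hd
  have hE : MemLp E 2 m := bdd_memLp' hm hb
  refine ⟨bd1_bd2 ⟨he, memLp_int hE, ?_⟩ hE, hb⟩
  have := tendsto_integral_of_dominated_convergence (F := fun k θ => ‖dil e k θ - E θ‖)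
    (f := fun _ => (0 : ℝ)) (μ := m) (fun _ => C + C) ?_ (integrable_const _) ?_ ?_
  · simpa using this
  · intro k; exact (((dil_cont he k).aestronglyMeasurable).sub hm).norm
  · intro k
    filter_upwards [hb] with θ hθ
    rw [norm_norm]
    exact (norm_sub_le _ _).trans (add_le_add (hC _ (rb_mem k θ)) hθ)
  · filter_upwards [hd] with θ hθ
    simpa using (hθ.sub_const (E θ)).norm

lemma n2_le_bdd {f : Tc → ℂ} {C : ℝ} (hC : 0 ≤ C) (h : ∀ᵐ θ ∂m, ‖f θ‖ ≤ C) : n2 f ≤ C := by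
  unfold n2
  have := eLpNorm_le_of_ae_bound (p := 2) h
  simp only [measure_univ, ENNReal.one_rpow, one_mul] at this
  exact ENNReal.toReal_le_of_le_ofReal hC this

lemma bd2_of_bdd {e} {C : ℝ} (he : HolDisc e) (hC : ∀ z ∈ uDisc, ‖e z‖ ≤ C) :
    ∃ E, Bd2 e E ∧ ∀ᵐ θ ∂m, ‖E θ‖ ≤ C := by
  have hC0 : 0 ≤ C := (norm_nonneg _).trans (hC 0 (by simp))
  obtain ⟨E, hE, -⟩ := bd2_exists he (K := C) fun k =>
    n2_le_bdd hC0 (ae_of_all _ fun θ => hC _ (rb_mem k θ))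
  refine ⟨E, hE, ?_⟩
  obtain ⟨ns, -, hns⟩ := hE.bd1.sub strictMono_id
  filter_upwards [hns] with θ hθ
  exact le_of_tendsto' hθ.norm fun k => hC _ (rb_mem _ θ)

lemma ps_of_bdd {c : ℕ → ℂ} {K : ℝ} (hc : ∀ n, ‖c n‖ ≤ K) {z : ℂ} (hz : z ∈ uDisc) :
    Summable (fun n => c n * z ^ n) := by
  rw [mem_ball_zero_iff] at hz
  refine Summable.of_norm_bounded (g := fun n => K * ‖z‖ ^ n)
    ((summable_geometric_of_lt_one (norm_nonneg _) hz).mul_left K) fun n => ?_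
  rw [norm_mul, norm_pow]; gcongr; exact hc n

lemma ext_H2 {F : Tc → ℂ} (hF : MemLp F 2 m) (h : ∀ n : ℤ, n < 0 → fourierCoeff F n = 0) :
    ∃ e, Bd2 e F := by
  let e : ℂ → ℂ := fun z => ∑' n : ℕ, fourierCoeff F n * z ^ n
  have hps : ∀ z ∈ uDisc, HasSum (fun n : ℕ => fourierCoeff F n * z ^ n) (e z) := fun z hz =>
    (ps_of_bdd (K := ∫ θ, ‖F θ‖ ∂m) (fun n => fc_le F n) hz).hasSum
  refine ⟨e, bd2_of_fc (ps_hol hps) hF fun n => ?_⟩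
  by_cases hn : 0 ≤ n
  · lift n to ℕ using hn
    exact (ps_uniq (c := fun n : ℕ => fourierCoeff F n) hps n).symm
  · rw [tc_neg _ (not_le.1 hn), h _ (not_le.1 hn)]

/-- (M) -/
lemma near_one {κ : ℂ → ℂ} (hk : HolDisc κ) (h1 : ∀ z ∈ uDisc, ‖κ z‖ ≤ 1) (k : ℕ) :
    n2 (fun θ => 1 - dil κ k θ) ^ 2 ≤ 2 - 2 * (κ 0).re := by
  have hm := (memLp_const (1 : ℂ) (p := 2) (μ := m)).sub (dil_memLp hk k 2)
  have e0 := n2_sq hm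
  have e1 : n2 (fun θ => 1 - dil κ k θ) ^ 2 = ∫ θ, ‖1 - dil κ k θ‖ ^ 2 ∂m := e0
  rw [e1]
  have hi := memLp_int (dil_memLp hk k 2)
  have h2 : ∫ θ, (dil κ k θ).re ∂m = (κ 0).re := by
    have h3 := fc_dil hk k 0
    rw [fc_def, tc_zero] at h3
    simp at h3
    rw [← h3]
    exact integral_re hi
  have i2 : Integrable (fun θ => 2 - 2 * (dil κ k θ).re) m :=
    (integrable_const _).sub (hi.re.const_mul 2)
  calc _ ≤ ∫ θ, (2 - 2 * (dil κ k θ).re) ∂m := by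
        apply integral_mono_of_nonneg (ae_of_all _ fun θ => by positivity) i2
        filter_upwards with θ
        have := h1 _ (rb_mem k θ)
        change ‖dil κ k θ‖ ≤ 1 at this
        have h5 : ‖dil κ k θ‖ ^ 2 ≤ 1 := by nlinarith [norm_nonneg (dil κ k θ)]
        rw [← Complex.normSq_eq_norm_sq, Complex.normSq_apply] at h5 ⊢
        simp; nlinarith
    _ = _ := by
        have hre : Integrable (fun θ => (dil κ k θ).re) m := hi.re
        rw [integral_sub (integrable_const _) (hre.const_mul 2), integral_const_mul]
        simp [h2]

/-- limiting version of (M) -/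
lemma near_one' {κ : ℂ → ℂ} {E} (hb : Bd2 κ E) (h1 : ∀ z ∈ uDisc, ‖κ z‖ ≤ 1) :
    n2 (fun θ => 1 - E θ) ^ 2 ≤ 2 - 2 * (κ 0).re := by
  have hm : ∀ k, MemLp (fun θ => 1 - dil κ k θ) 2 m := fun k =>
    (memLp_const (1 : ℂ) (p := 2) (μ := m)).sub (dil_memLp hb.1 k 2)
  have h3 : ∀ k, n2 (fun θ => 1 - E θ) ≤
      Real.sqrt (2 - 2 * (κ 0).re) + n2 (fun θ => dil κ k θ - E θ) := by
    intro k
    have := n2_add (hm k) ((dil_memLp hb.1 k 2).sub hb.2.1)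
    have e1 : (fun θ => 1 - E θ) = fun θ => (1 - dil κ k θ) + (dil κ k - E) θ := by
      ext θ; simp
    rw [e1]
    refine this.trans (add_le_add ?_ le_rfl)
    exact Real.le_sqrt_of_sq_le (near_one hb.1 h1 k)
  have h4 : n2 (fun θ => 1 - E θ) ≤ Real.sqrt (2 - 2 * (κ 0).re) := by
    refine ge_of_tendsto' (x := atTop) (f := fun k => Real.sqrt (2 - 2 * (κ 0).re) + n2 (fun θ => dil κ k θ - E θ)) ?_ h3
    simpa using hb.2.2.const_add (Real.sqrt (2 - 2 * (κ 0).re))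
  have h5 : 0 ≤ 2 - 2 * (κ 0).re := (sq_nonneg _).trans (near_one hb.1 h1 0)
  calc _ ≤ Real.sqrt (2 - 2 * (κ 0).re) ^ 2 := by
        have := n2_nonneg (fun θ => 1 - E θ); gcongr
    _ = _ := Real.sq_sqrt h5

/-- (T) -/
lemma tc_near {g : ℂ → ℂ} (hg : HolDisc g) (n : ℕ) : ∃ C : ℝ, 0 ≤ C ∧ ∀ κ : ℂ → ℂ, HolDisc κ →
    (∀ z ∈ uDisc, ‖κ z‖ ≤ 1) →
    ‖tc (fun z => κ z * g z) n - tc g n‖ ≤ C * Real.sqrt (2 - 2 * (κ 0).re) := by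
  refine ⟨2 ^ n * n2 (dil g 0), mul_nonneg (by positivity) (n2_nonneg _), fun κ hk h1 => ?_⟩
  have e1 := fc_dil (hol_mul hk hg) 0 n
  have e2 := fc_dil hg 0 n
  rw [rr_zero] at e1 e2
  have hm : MemLp (fun θ => 1 - dil κ 0 θ) 2 m :=
    (memLp_const (1 : ℂ) (p := 2) (μ := m)).sub (dil_memLp hk 0 2)
  have h3 := n2_cs' hm (dil_memLp hg 0 2) n
  have e3 : (fun θ => (1 - dil κ 0 θ) * dil g 0 θ) = fun θ => dil g 0 θ -
      dil (fun z => κ z * g z) 0 θ := by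
    ext θ; simp [dil]; ring
  rw [e3, fc_sub (memLp_int (dil_memLp hg 0 2)) (memLp_int (dil_memLp (hol_mul hk hg) 0 2)), e1, e2,
    ← sub_mul, norm_mul, norm_sub_rev] at h3
  have h4 : n2 (fun θ => 1 - dil κ 0 θ) ≤ Real.sqrt (2 - 2 * (κ 0).re) :=
    Real.le_sqrt_of_sq_le (near_one hk h1 0)
  have e5 : ‖((1 / 2 : ℝ) : ℂ) ^ (n : ℤ).natAbs‖ = (2 ^ n)⁻¹ := by
    rw [Int.natAbs_natCast, norm_pow, Complex.norm_real]; norm_num; rw [one_div, inv_pow]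
  rw [e5] at h3
  have h6 : ‖tc (fun z => κ z * g z) n - tc g n‖ ≤ 2 ^ n * (n2 (fun θ => 1 - dil κ 0 θ) * n2 (dil g 0)) := by
    rwa [← div_eq_mul_inv, div_le_iff₀' (by positivity)] at h3
  refine h6.trans ?_
  have := n2_nonneg (dil g 0)
  calc _ ≤ 2 ^ n * (Real.sqrt (2 - 2 * (κ 0).re) * n2 (dil g 0)) := by gcongr
    _ = _ := by ring

instance m_wreg : m.WeaklyRegular := by unfold m; infer_instance

/-- Herglotz transform -/
def HH (w : Tc → ℂ) (z : ℂ) : ℂ := ∫ θ, ((bd θ + z) / (bd θ - z)) * w θ ∂m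

/-- coefficients of the Herglotz kernel -/
def dc (n : ℕ) : ℂ := if n = 0 then 1 else 2

lemma dc_norm (n : ℕ) : ‖dc n‖ ≤ 2 := by unfold dc; split_ifs <;> simp

lemma geo_ker {q : ℂ} (hq : ‖q‖ < 1) : HasSum (fun n => dc n * q ^ n) ((1 + q) / (1 - q)) := by
  have h1 := (hasSum_geometric_of_norm_lt_one hq).mul_left 2
  have h2 := h1.sub (hasSum_ite_eq 0 (1 : ℂ))
  have h3 : (1 - q) ≠ 0 := by
    intro h; have : q = 1 := by linear_combination -h
    rw [this] at hq; simp at hq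
  have e1 : (fun n => dc n * q ^ n) = fun n : ℕ => 2 * q ^ n - if n = 0 then 1 else 0 := by
    ext n; unfold dc; split_ifs with h
    · subst h; norm_num
    · simp
  have e2 : (1 + q) / (1 - q) = 2 * (1 - q)⁻¹ - 1 := by field_simp; ring
  rw [e1, e2]; exact h2

lemma bd_sub_ne {z : ℂ} (hz : z ∈ uDisc) (θ : Tc) : bd θ - z ≠ 0 := by
  intro h
  have : bd θ = z := by linear_combination h
  rw [mem_ball_zero_iff, ← this, bd_norm] at hz; simp at hz

lemma ker_cont {z : ℂ} (hz : z ∈ uDisc) : Continuous fun θ => (bd θ + z) / (bd θ - z) :=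
  (bd_cont.add continuous_const).div (bd_cont.sub continuous_const) (bd_sub_ne hz)

lemma ker_int {z : ℂ} (hz : z ∈ uDisc) {w : Tc → ℂ} (hw : Integrable w m) :
    Integrable (fun θ => ((bd θ + z) / (bd θ - z)) * w θ) m := by
  obtain ⟨C, hC⟩ := isCompact_univ.exists_bound_of_continuousOn (ker_cont hz).continuousOn
  exact hw.bdd_mul (c := C) (ker_cont hz).aestronglyMeasurable (ae_of_all _ fun θ => hC θ trivial)

lemma hh_ps {w : Tc → ℂ} (hw : Integrable w m) {z : ℂ} (hz : z ∈ uDisc) :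
    HasSum (fun n : ℕ => (dc n * fourierCoeff w n) * z ^ n) (HH w z) := by
  have hz' := hz
  rw [mem_ball_zero_iff] at hz'
  have := hasSum_integral_of_dominated_convergence (μ := m)
    (F := fun (n : ℕ) θ => dc n * (z * (bd θ)⁻¹) ^ n * w θ)
    (f := fun θ => ((bd θ + z) / (bd θ - z)) * w θ)
    (fun n θ => 2 * ‖z‖ ^ n * ‖w θ‖) ?_ ?_ ?_ ?_ ?_
  · have e1 : (fun n : ℕ => (dc n * fourierCoeff w n) * z ^ n) =
        fun n : ℕ => ∫ θ, dc n * (z * (bd θ)⁻¹) ^ n * w θ ∂m := ?_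
    · rw [e1]; exact this
    ext n
    rw [fc_def, mul_right_comm, ← integral_const_mul]
    congr 1; ext θ
    rw [zpow_neg, zpow_natCast, mul_pow, inv_pow]; ring
  · intro n
    refine Continuous.aestronglyMeasurable ?_ |>.mul hw.1
    exact continuous_const.mul ((continuous_const.mul (bd_cont.inv₀ bd_ne)).pow n)
  · intro n; filter_upwards with θ
    rw [norm_mul, norm_mul, norm_pow, norm_mul, norm_inv, bd_norm, inv_one, mul_one]
    gcongr; exact dc_norm n
  · filter_upwards with θ
    exact ((summable_geometric_of_lt_one (norm_nonneg _) hz').mul_left 2).mul_right _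
  · have : (fun θ => ∑' n : ℕ, 2 * ‖z‖ ^ n * ‖w θ‖) = fun θ => (∑' n : ℕ, 2 * ‖z‖ ^ n) * ‖w θ‖ := by
      ext θ; rw [tsum_mul_right]
    rw [this]; exact hw.norm.const_mul _
  · filter_upwards with θ
    have hq : ‖z * (bd θ)⁻¹‖ < 1 := by rw [norm_mul, norm_inv, bd_norm]; simpa using hz'
    have e1 : (bd θ + z) / (bd θ - z) = (1 + z * (bd θ)⁻¹) / (1 - z * (bd θ)⁻¹) := ?_
    · rw [e1]; exact (geo_ker hq).mul_right (w θ)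
    have h1 := bd_ne θ
    have h2 := bd_sub_ne hz θ
    have h3 : 1 - z * (bd θ)⁻¹ ≠ 0 := by
      intro h; apply h2
      field_simp at h; simpa using h
    rw [div_eq_div_iff h2 h3]
    field_simp

lemma hh_hol {w : Tc → ℂ} (hw : Integrable w m) : HolDisc (HH w) :=
  ps_hol fun _ hz => hh_ps hw hz

lemma hh_tc {w : Tc → ℂ} (hw : Integrable w m) (n : ℕ) : tc (HH w) n = dc n * fourierCoeff w n :=
  ps_uniq (fun _ hz => hh_ps hw hz) n

lemma hh_zero (w : Tc → ℂ) : HH w 0 = ∫ θ, w θ ∂m := by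
  unfold HH; congr 1; ext θ; simp [bd_ne θ]

lemma hh_add {w v : Tc → ℂ} (hw : Integrable w m) (hv : Integrable v m) {z : ℂ} (hz : z ∈ uDisc) :
    HH (fun θ => w θ + v θ) z = HH w z + HH v z := by
  unfold HH; rw [← integral_add (ker_int hz hw) (ker_int hz hv)]; congr 1; ext θ; ring

lemma hh_smul (c : ℂ) (w : Tc → ℂ) (z : ℂ) :
    HH (fun θ => c * w θ) z = c * HH w z := by
  unfold HH; rw [← integral_const_mul]; congr 1; ext θ; ring

lemma ker_re {z : ℂ} (hz : z ∈ uDisc) (θ : Tc) : 0 ≤ ((bd θ + z) / (bd θ - z)).re := by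
  rw [Complex.div_re, ← add_div]
  apply div_nonneg _ (Complex.normSq_nonneg _)
  have h1 : normSq (bd θ) = 1 := by rw [Complex.normSq_eq_norm_sq, bd_norm]; norm_num
  have h2 : normSq z ≤ 1 := by
    rw [Complex.normSq_eq_norm_sq]; rw [mem_ball_zero_iff] at hz; nlinarith [norm_nonneg z]
  rw [Complex.normSq_apply] at h1 h2
  simp; nlinarith

lemma hh_re {w : Tc → ℝ} (hw : Integrable w m) {z : ℂ} (hz : z ∈ uDisc) :
    (HH (fun θ => (w θ : ℂ)) z).re = ∫ θ, ((bd θ + z) / (bd θ - z)).re * w θ ∂m := by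
  have h := integral_re (𝕜 := ℂ) (ker_int hz hw.ofReal)
  have : (HH (fun θ => (w θ : ℂ)) z).re = RCLike.re (∫ θ, ((bd θ + z) / (bd θ - z)) * (w θ : ℂ) ∂m) := rfl
  rw [this]
  refine Eq.trans h.symm ?_
  congr 1; ext θ; simp only [RCLike.re_to_complex]; exact Complex.re_mul_ofReal _ _

lemma hh_re_mono {w v : Tc → ℝ} (hw : Integrable w m) (hv : Integrable v m)
    (h : ∀ᵐ θ ∂m, w θ ≤ v θ) {z : ℂ} (hz : z ∈ uDisc) :
    (HH (fun θ => (w θ : ℂ)) z).re ≤ (HH (fun θ => (v θ : ℂ)) z).re := by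
  rw [hh_re hw hz, hh_re hv hz]
  have i : ∀ {w : Tc → ℝ}, Integrable w m →
      Integrable (fun θ => ((bd θ + z) / (bd θ - z)).re * w θ) m := by
    intro w hw
    have := (ker_int hz hw.ofReal).re
    refine this.congr (ae_of_all _ fun θ => ?_)
    simp only [RCLike.re_to_complex]; exact Complex.re_mul_ofReal _ _
  apply integral_mono_ae (i hw) (i hv)
  filter_upwards [h] with θ hθ
  exact mul_le_mul_of_nonneg_left hθ (ker_re hz θ)

lemma hh_re_nonneg {w : Tc → ℝ} (hw : Integrable w m)
    (h : ∀ᵐ θ ∂m, 0 ≤ w θ) {z : ℂ} (hz : z ∈ uDisc) :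
    0 ≤ (HH (fun θ => (w θ : ℂ)) z).re := by
  have := hh_re_mono (integrable_const 0) hw h hz
  simpa [HH] using this

/-- Poisson integral -/
def Pw (w : Tc → ℂ) (z : ℂ) : ℂ := (HH w z + conj (HH (fun θ => conj (w θ)) z)) / 2

lemma int_conj {w : Tc → ℂ} (hw : Integrable w m) : Integrable (fun θ => conj (w θ)) m :=
  memLp_one_iff_integrable.1 (conj_memLp (memLp_one_iff_integrable.2 hw))

lemma pw_eq {w : Tc → ℂ} (hw : Integrable w m) {z : ℂ} (hz : z ∈ uDisc) :
    Pw w z = ∫ θ, ((((bd θ + z) / (bd θ - z)).re : ℝ) : ℂ) * w θ ∂m := by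
  unfold Pw HH
  rw [← integral_conj, ← integral_add (ker_int hz hw), ← integral_div]
  · congr 1; ext θ
    rw [map_mul, Complex.conj_conj, ← add_mul, Complex.add_conj]; push_cast; ring
  · exact int_conj (ker_int hz (int_conj hw))

lemma pw_norm {w : Tc → ℂ} (hw : Integrable w m) {z : ℂ} (hz : z ∈ uDisc) :
    ‖Pw w z‖ ≤ (HH (fun θ => ((‖w θ‖ : ℝ) : ℂ)) z).re := by
  rw [pw_eq hw hz, hh_re hw.norm hz]
  refine (norm_integral_le_integral_norm _).trans (le_of_eq ?_)
  congr 1; ext θ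
  rw [norm_mul, Complex.norm_real, Real.norm_of_nonneg (ker_re hz θ)]

lemma pw_cont {w : Tc → ℂ} (hw : Integrable w m) (k : ℕ) : Continuous (dil (Pw w) k) := by
  have h1 := dil_cont (hh_hol hw) k
  have h2 := dil_cont (hh_hol (int_conj hw)) k
  exact (h1.add (Complex.continuous_conj.comp h2)).div_const 2

lemma pw_int_le {w : Tc → ℂ} (hw : Integrable w m) (k : ℕ) :
    ∫ θ, ‖dil (Pw w) k θ‖ ∂m ≤ ∫ θ, ‖w θ‖ ∂m := by
  have hh := hh_hol (hw.norm.ofReal (𝕜 := ℂ))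
  have hi := memLp_int (dil_memLp hh k 2)
  have h3 := fc_dil hh k 0
  rw [fc_def, tc_zero, hh_zero] at h3
  simp only [neg_zero, zpow_zero, one_mul, Int.natAbs_zero, pow_zero, mul_one] at h3
  have h4 : ∫ θ, (dil (HH fun θ => ((‖w θ‖ : ℝ) : ℂ)) k θ).re ∂m = ∫ θ, ‖w θ‖ ∂m := by
    have h5 : ∫ θ, (dil (HH fun θ => ((‖w θ‖ : ℝ) : ℂ)) k θ).re ∂m =
      (∫ θ, dil (HH fun θ => ((‖w θ‖ : ℝ) : ℂ)) k θ ∂m).re := integral_re hi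
    rw [h5]
    refine (congrArg Complex.re h3).trans ?_
    have h6 : (∫ θ, (((‖w θ‖ : ℝ)) : ℂ) ∂m) = ((∫ θ, ‖w θ‖ ∂m : ℝ) : ℂ) := integral_ofReal
    refine (congrArg Complex.re h6).trans ?_
    simp
  rw [← h4]
  exact integral_mono_of_nonneg (ae_of_all _ fun θ => norm_nonneg _) hi.re
    (ae_of_all _ fun θ => pw_norm hw (rb_mem k θ))

lemma hh_n2 {w : Tc → ℂ} (hw : MemLp w 2 m) (k : ℕ) : n2 (dil (HH w) k) ≤ 2 * n2 w := by
  have hh := hh_hol (memLp_int hw)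
  have hp := parseval (dil_memLp hh k 2)
  have hq := (parseval hw).mul_left 4
  have h1 : n2 (dil (HH w) k) ^ 2 ≤ 4 * n2 w ^ 2 := by
    refine hasSum_le (fun n => ?_) hp hq
    rw [fc_dil hh]
    by_cases hn : 0 ≤ n
    · lift n to ℕ using hn
      rw [hh_tc (memLp_int hw), norm_mul, norm_mul, norm_pow, Complex.norm_real,
        Real.norm_of_nonneg (rr_nonneg k)]
      have h5 : rr k ^ (n : ℤ).natAbs ≤ 1 := pow_le_one₀ (rr_nonneg k) (rr_lt k).le
      have h6 : 0 ≤ rr k ^ (n : ℤ).natAbs := pow_nonneg (rr_nonneg k) _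
      have h7 : ‖dc n‖ * ‖fourierCoeff w n‖ * rr k ^ (n : ℤ).natAbs ≤ 2 * ‖fourierCoeff w n‖ * 1 := by
        gcongr; exact dc_norm n
      calc _ ≤ (2 * ‖fourierCoeff w n‖ * 1) ^ 2 := by gcongr
        _ = _ := by ring
    · rw [tc_neg _ (not_le.1 hn)]; simp
  have := n2_nonneg w
  exact abs_le_of_sq_le_sq' (h1.trans (le_of_eq (by ring))) (by positivity) |>.2

lemma hh_bd2 {w : Tc → ℂ} (hw : MemLp w 2 m) : ∃ E, Bd2 (HH w) E ∧ n2 E ≤ 2 * n2 w :=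
  bd2_exists (hh_hol (memLp_int hw)) (hh_n2 hw)

lemma pw_conv2 {w : Tc → ℂ} (hw : MemLp w 2 m) :
    Tendsto (fun k => ∫ θ, ‖dil (Pw w) k θ - w θ‖ ∂m) atTop (𝓝 0) := by
  obtain ⟨E, hE, -⟩ := hh_bd2 hw
  obtain ⟨G, hG, -⟩ := hh_bd2 (conj_memLp hw)
  have hwG := conj_memLp hG.2.1
  have hD : MemLp (fun θ => (2⁻¹ : ℂ) * (E θ + conj (G θ)) - w θ) 2 m :=
    ((hE.2.1.add hwG).const_mul _).sub hw
  have h0 : (fun θ => (2⁻¹ : ℂ) * (E θ + conj (G θ)) - w θ) =ᵐ[m] 0 := by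
    apply fc_zero_ae hD
    intro n
    have hi : Integrable (fun θ => (2⁻¹ : ℂ) * (E θ + conj (G θ))) m :=
      (memLp_int (hE.2.1.add hwG)).const_mul _
    rw [fc_sub hi (memLp_int hw), fc_smul,
      fc_add (memLp_int hE.2.1) (memLp_int hwG), fc_conj, hE.fc, hG.fc]
    rcases lt_trichotomy n 0 with hn | hn | hn
    · obtain ⟨j, hj⟩ : ∃ j : ℕ, -n = j := ⟨n.natAbs, by omega⟩
      rw [tc_neg _ hn, hj, hh_tc (memLp_int (conj_memLp hw)), fc_conj, ← hj, neg_neg]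
      have : dc j = 2 := by unfold dc; rw [if_neg (by omega)]
      rw [this, map_mul, Complex.conj_conj, Complex.conj_ofNat]; ring
    · subst hn
      have h1 := hh_tc (memLp_int hw) 0
      have h2 := hh_tc (memLp_int (conj_memLp hw)) 0
      simp only [dc, if_true, one_mul, Nat.cast_zero, fc_conj, neg_zero] at h1 h2
      rw [neg_zero, h1, h2, Complex.conj_conj]; ring
    · rw [tc_neg (n := -n) _ (by omega)]
      lift n to ℕ using hn.le
      rw [hh_tc (memLp_int hw)]
      have : dc n = 2 := by unfold dc; rw [if_neg (by omega)]
      rw [this]; simp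
  have hw' : ∀ᵐ θ ∂m, w θ = (2⁻¹ : ℂ) * (E θ + conj (G θ)) := by
    filter_upwards [h0] with θ hθ
    simp only [Pi.zero_apply] at hθ
    linear_combination -hθ
  have hlim := (hE.bd1.2.2.add hG.bd1.2.2)
  rw [add_zero] at hlim
  refine squeeze_zero (fun k => integral_nonneg fun θ => norm_nonneg _) (fun k => ?_) hlim
  have i1 : Integrable (fun θ => ‖dil (HH w) k θ - E θ‖) m :=
    (memLp_int ((dil_memLp hE.1 k 2).sub hE.2.1)).norm
  have i2 : Integrable (fun θ => ‖dil (HH fun θ => conj (w θ)) k θ - G θ‖) m :=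
    (memLp_int ((dil_memLp hG.1 k 2).sub hG.2.1)).norm
  rw [← integral_add i1 i2]
  apply integral_mono_of_nonneg (ae_of_all _ fun θ => norm_nonneg _) (i1.add i2)
  filter_upwards [hw'] with θ hθ
  rw [hθ]
  have e1 : dil (Pw w) k θ - 2⁻¹ * (E θ + conj (G θ)) = 2⁻¹ * ((dil (HH w) k θ - E θ) +
      conj (dil (HH fun θ => conj (w θ)) k θ - G θ)) := by
    simp only [dil, Pw, map_sub]; ring
  rw [e1, norm_mul]
  have h5 := norm_add_le (dil (HH w) k θ - E θ) (conj (dil (HH fun θ => conj (w θ)) k θ - G θ))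
  rw [Complex.norm_conj] at h5
  have h6 : ‖(2⁻¹ : ℂ)‖ ≤ 1 := by norm_num
  calc _ ≤ 1 * ‖(dil (HH w) k θ - E θ) + conj (dil (HH fun θ => conj (w θ)) k θ - G θ)‖ := by gcongr
    _ ≤ _ := by rw [one_mul]; exact h5

lemma pw_sub {w v : Tc → ℂ} (hw : Integrable w m) (hv : Integrable v m) {z : ℂ} (hz : z ∈ uDisc) :
    Pw (fun θ => w θ - v θ) z = Pw w z - Pw v z := by
  rw [pw_eq hw hz, pw_eq hv hz, pw_eq (w := fun θ => w θ - v θ) (hw.sub hv) hz, ← integral_sub]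
  · congr 1; ext θ; ring
  all_goals
    have hc : Continuous fun θ => ((((bd θ + z) / (bd θ - z)).re : ℝ) : ℂ) :=
      Complex.continuous_ofReal.comp (Complex.continuous_re.comp (ker_cont hz))
    obtain ⟨C, hC⟩ := isCompact_univ.exists_bound_of_continuousOn hc.continuousOn
  · exact hw.bdd_mul (c := C) hc.aestronglyMeasurable (ae_of_all _ fun θ => hC θ trivial)
  · exact hv.bdd_mul (c := C) hc.aestronglyMeasurable (ae_of_all _ fun θ => hC θ trivial)

lemma l2_approx {w : Tc → ℂ} (hw : Integrable w m) {ε : ℝ} (hε : 0 < ε) :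
    ∃ v : Tc → ℂ, MemLp v 2 m ∧ ∫ θ, ‖w θ - v θ‖ ∂m ≤ ε := by
  obtain ⟨g, hg, -⟩ := hw.exists_boundedContinuous_integral_sub_le hε
  exact ⟨g, cont_memLp g.continuous 2, hg⟩

lemma pw_int {w : Tc → ℂ} (hw : Integrable w m) (k : ℕ) : Integrable (dil (Pw w) k) m :=
  memLp_int (cont_memLp (pw_cont hw k) 2)

lemma pw_conv {w : Tc → ℂ} (hw : Integrable w m) :
    Tendsto (fun k => ∫ θ, ‖dil (Pw w) k θ - w θ‖ ∂m) atTop (𝓝 0) := by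
  rw [Metric.tendsto_atTop]
  intro ε hε
  obtain ⟨v, hv, hvw⟩ := l2_approx hw (ε := ε / 3) (by linarith)
  have hvi := memLp_int hv
  obtain ⟨N, hN⟩ := (Metric.tendsto_atTop.1 (pw_conv2 hv)) (ε / 3) (by linarith)
  refine ⟨N, fun k hk => ?_⟩
  have h1 := hN k hk
  rw [Real.dist_0_eq_abs, abs_of_nonneg (integral_nonneg fun θ => norm_nonneg _)] at h1 ⊢
  have hd : Integrable (fun θ => w θ - v θ) m := hw.sub hvi
  have h2 := pw_int_le hd k
  have j1 := (pw_int hd k).norm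
  have j2 : Integrable (fun θ => ‖(dil (Pw v) k - v) θ‖) m := ((pw_int hvi k).sub hvi).norm
  have j3 := hd.norm
  have j12 : Integrable (fun θ => ‖dil (Pw fun θ => w θ - v θ) k θ‖ + ‖(dil (Pw v) k - v) θ‖) m :=
    j1.add j2
  calc _ ≤ ∫ θ, ((‖dil (Pw fun θ => w θ - v θ) k θ‖ + ‖(dil (Pw v) k - v) θ‖) + ‖w θ - v θ‖) ∂m := by
        apply integral_mono_of_nonneg (ae_of_all _ fun θ => norm_nonneg _) (j12.add j3)
        filter_upwards with θ
        have e1 : dil (Pw w) k θ - w θ = dil (Pw fun θ => w θ - v θ) k θ + (dil (Pw v) k - v) θ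
            + (v θ - w θ) := by
          simp only [dil, Pi.sub_apply]; rw [pw_sub hw hvi (rb_mem k θ)]; ring
        rw [e1]
        refine norm_add₃_le.trans (le_of_eq ?_)
        rw [norm_sub_rev (v θ)]; rfl
    _ = _ := by rw [integral_add j12 j3, integral_add j1 j2]
    _ < ε := by
        have : ∫ θ, ‖(dil (Pw v) k - v) θ‖ ∂m < ε / 3 := h1
        linarith

lemma tc_congr {e g : ℂ → ℂ} (hg : HolDisc g) (h : ∀ z ∈ uDisc, e z = g z) (n : ℤ) :
    tc e n = tc g n := by
  by_cases hn : 0 ≤ n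
  · lift n to ℕ using hn
    refine ps_uniq (c := fun n => tc g n) (fun z hz => ?_) n
    rw [h z hz]; exact hol_ps hg hz
  · rw [tc_neg _ (not_le.1 hn), tc_neg _ (not_le.1 hn)]

lemma Bd2.bound {e E} {C : ℝ} (hE : Bd2 e E) (hC : ∀ z ∈ uDisc, ‖e z‖ ≤ C) :
    ∀ᵐ θ ∂m, ‖E θ‖ ≤ C := by
  obtain ⟨ns, -, hns⟩ := hE.bd1.sub strictMono_id
  filter_upwards [hns] with θ hθ
  exact le_of_tendsto' hθ.norm fun k => hC _ (rb_mem _ θ)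

lemma hh_one {z : ℂ} (hz : z ∈ uDisc) : HH (fun _ => 1) z = 1 := by
  have h1 : ∀ z ∈ uDisc, HasSum (fun n : ℕ => (if n = 0 then (1 : ℂ) else 0) * z ^ n)
      ((fun _ => (1 : ℂ)) z) := by
    intro z _
    have := hasSum_ite_eq (0 : ℕ) (1 : ℂ)
    refine this.congr_fun ?_ |> fun h => h
    intro n; split_ifs with h
    · subst h; simp
    · simp
  have h2 : ∀ n : ℕ, fourierCoeff (fun _ : Tc => (1 : ℂ)) n = if n = 0 then (1 : ℂ) else 0 := by
    intro n
    have := fc_ps h1 0 n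
    have e : (dil (fun _ => (1 : ℂ)) 0) = fun _ : Tc => (1 : ℂ) := rfl
    rw [e] at this
    rw [this, if_pos (by omega), Int.toNat_natCast]
    split_ifs with h
    · subst h; simp
    · simp
  have h3 := hh_ps (integrable_const (1 : ℂ)) hz
  refine h3.unique ?_
  have := h1 z hz
  refine this.congr_fun ?_ |> fun h => h
  intro n; rw [h2]; unfold dc; split_ifs <;> simp

/-- structural facts about the outer function of a pair -/
lemma outer_facts (P : BPair) : ∃ (α : ℂ) (l : Tc → ℝ), ‖α‖ = 1 ∧ Integrable l m ∧
    (∀ z ∈ uDisc, P.a z = α * Complex.exp (HH (fun θ => (l θ : ℂ)) z)) ∧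
    (∀ᵐ θ ∂m, l θ ≤ 0) ∧ (∀ᵐ θ ∂m, ‖P.as' θ‖ = Real.exp (l θ)) := by
  obtain ⟨hol, α, w, hα, -, hl, ha⟩ := P.a_outer
  have hlc : Integrable (fun θ => ((Real.log (w θ) : ℝ) : ℂ)) m := hl.ofReal
  have hmod : ∀ᵐ θ ∂m, ‖P.as' θ‖ = Real.exp (Real.log (w θ)) := by
    obtain ⟨ns, hns, hlim⟩ := sub_ae (pw_int hlc) hlc (pw_conv hlc)
    filter_upwards [hlim, P.a_bdry.dil] with θ h1 h2
    have h3 := (h2.comp hns.tendsto_atTop).norm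
    have h4 := (Real.continuous_exp.tendsto _).comp ((Complex.continuous_re.tendsto _).comp h1)
    refine tendsto_nhds_unique h3 (h4.congr fun i => ?_)
    simp only [Function.comp, dil]
    have hz := rb_mem (ns i) θ
    have e1 : ‖P.a ((rr (ns i) : ℂ) * bd θ)‖ = ‖α * Complex.exp (HH (fun θ => ((Real.log (w θ) : ℝ) : ℂ))
        ((rr (ns i) : ℂ) * bd θ))‖ := congrArg norm (ha _ hz)
    rw [e1, norm_mul, hα, one_mul, Complex.norm_exp]
    congr 1
    simp only [Pw, Complex.conj_ofReal, Complex.add_conj]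
    simp
  refine ⟨α, _, hα, hl, ha, ?_, hmod⟩
  filter_upwards [hmod, P.pyth] with θ h1 h2
  by_contra hc
  push Not at hc
  have := Real.add_one_lt_exp hc.ne'
  nlinarith [sq_nonneg ‖P.bs θ‖]

/-- Approximate inverses of `a`. -/
structure Kap (a : ℂ → ℂ) (as : Tc → ℂ) where
  e : ℕ → ℂ → ℂ
  E : ℕ → Tc → ℂ
  C : ℕ → ℝ
  abd : Bd2 a as
  ale : ∀ z ∈ uDisc, ‖a z‖ ≤ 1
  ane : ∀ z ∈ uDisc, a z ≠ 0
  asne : ∀ᵐ θ ∂m, as θ ≠ 0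
  ebd : ∀ N, Bd2 (e N) (E N)
  ele : ∀ N, ∀ᵐ θ ∂m, ‖E N θ‖ ≤ C N
  kle : ∀ N, ∀ z ∈ uDisc, ‖a z * e N z‖ ≤ 1
  lim : Tendsto (fun N => Real.sqrt (2 - 2 * (a 0 * e N 0).re)) atTop (𝓝 0)

lemma kap_exists (P : BPair) : Nonempty (Kap P.a P.as') := by
  obtain ⟨α, l, hα, hl, ha, hl0, has⟩ := outer_facts P
  have hol := P.a_outer.1
  have ale : ∀ z ∈ uDisc, ‖P.a z‖ ≤ 1 := by
    intro z hz
    rw [ha z hz, norm_mul, hα, one_mul, Complex.norm_exp]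
    have := hh_re_mono hl (integrable_const (0 : ℝ)) hl0 hz
    have h0 : HH (fun _ => ((0 : ℝ) : ℂ)) z = 0 := by simp [HH]
    rw [h0] at this
    exact Real.exp_le_one_iff.2 this
  -- truncations
  let lN : ℕ → Tc → ℝ := fun N θ => max (l θ) (-(N : ℝ))
  have hlN : ∀ N, Integrable (lN N) m := fun N => hl.sup (integrable_const _)
  let e : ℕ → ℂ → ℂ := fun N z => conj α * Complex.exp (-HH (fun θ => (lN N θ : ℂ)) z)
  have hehol : ∀ N, HolDisc (e N) := fun N =>
    ((hh_hol (hlN N).ofReal).neg.cexp).const_mul _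
  have hele : ∀ N, ∀ z ∈ uDisc, ‖e N z‖ ≤ Real.exp N := by
    intro N z hz
    simp only [e]
    rw [norm_mul, Complex.norm_conj, hα, one_mul, Complex.norm_exp]
    apply Real.exp_le_exp.2
    have h1 := hh_re_mono (integrable_const (-(N : ℝ))) (hlN N) (ae_of_all _ fun θ => le_max_right _ _) hz
    have h2 : HH (fun _ => ((-(N : ℝ) : ℝ) : ℂ)) z = -(N : ℂ) := by
      have := hh_smul (-(N : ℂ)) (fun _ => 1) z
      rw [hh_one hz] at this
      simpa using this
    rw [h2] at h1
    simp at h1 ⊢; linarith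
  have hk : ∀ N, ∀ z ∈ uDisc, P.a z * e N z = Complex.exp (HH (fun θ => ((l θ - lN N θ : ℝ) : ℂ)) z) := by
    intro N z hz
    have e1 : HH (fun θ => ((l θ - lN N θ : ℝ) : ℂ)) z =
        HH (fun θ => (l θ : ℂ)) z - HH (fun θ => (lN N θ : ℂ)) z := by
      have h1 := hh_add (hl.ofReal (𝕜 := ℂ)) ((hlN N).ofReal (𝕜 := ℂ) |>.const_mul (-1)) hz
      have h2 := hh_smul (-1) (fun θ => (lN N θ : ℂ)) z
      have h3 : (fun θ => ((l θ - lN N θ : ℝ) : ℂ)) = fun θ => (l θ : ℂ) + (-1) * (lN N θ : ℂ) := by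
        ext θ; push_cast; ring
      rw [h3]
      refine h1.trans ?_
      rw [sub_eq_add_neg]; congr 1
      refine h2.trans ?_; ring
    rw [ha z hz, e1, sub_eq_add_neg, Complex.exp_add]
    simp only [e]
    have h4 : α * conj α = 1 := by
      rw [Complex.mul_conj, Complex.normSq_eq_norm_sq, hα]; simp
    linear_combination (Complex.exp (HH (fun θ => (l θ : ℂ)) z) *
      Complex.exp (-HH (fun θ => (lN N θ : ℂ)) z)) * h4
  have hkle : ∀ N, ∀ z ∈ uDisc, ‖P.a z * e N z‖ ≤ 1 := by
    intro N z hz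
    rw [hk N z hz, Complex.norm_exp]
    have := hh_re_mono (hl.sub (hlN N)) (integrable_const (0 : ℝ))
      (ae_of_all _ fun θ => sub_nonpos.2 (le_max_left _ _)) hz
    have h0 : HH (fun _ => ((0 : ℝ) : ℂ)) z = 0 := by simp [HH]
    rw [h0] at this
    exact Real.exp_le_one_iff.2 this
  have h_intl : Tendsto (fun N => ∫ θ, (l θ - lN N θ) ∂m) atTop (𝓝 0) := by
    have := tendsto_integral_of_dominated_convergence (μ := m) (F := fun N θ => l θ - lN N θ)
      (f := fun _ => (0 : ℝ)) (fun θ => ‖l θ‖) (fun N => (hl.sub (hlN N)).1) hl.norm ?_ ?_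
    · simpa using this
    · intro N
      filter_upwards [hl0] with θ hθ
      have h1 : l θ ≤ lN N θ := le_max_left _ _
      have h2 : lN N θ ≤ 0 := max_le hθ (by simp)
      rw [Real.norm_eq_abs, Real.norm_eq_abs, abs_le]
      rw [abs_of_nonpos hθ]
      constructor <;> linarith
    · filter_upwards with θ
      obtain ⟨N0, hN0⟩ := exists_nat_ge (-l θ)
      refine tendsto_const_nhds.congr' ?_
      filter_upwards [eventually_ge_atTop N0] with N hN
      have : (N0 : ℝ) ≤ N := by exact_mod_cast hN
      simp only [lN]
      rw [max_eq_left (by linarith), sub_self]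
  have hlim : Tendsto (fun N => Real.sqrt (2 - 2 * (P.a 0 * e N 0).re)) atTop (𝓝 0) := by
    have e1 : ∀ N, (P.a 0 * e N 0).re = Real.exp (∫ θ, (l θ - lN N θ) ∂m) := by
      intro N
      rw [hk N 0 (by simp), hh_zero]
      have : ∫ θ, ((l θ - lN N θ : ℝ) : ℂ) ∂m = ((∫ θ, (l θ - lN N θ) ∂m : ℝ) : ℂ) := integral_ofReal
      rw [this, ← Complex.ofReal_exp, Complex.ofReal_re]
    simp only [e1]
    have h1 : Continuous fun x : ℝ => Real.sqrt (2 - 2 * Real.exp x) := by fun_prop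
    have h2 := (h1.tendsto 0).comp h_intl
    have h3 : Real.sqrt (2 - 2 * Real.exp 0) = 0 := by simp
    rw [h3] at h2
    exact h2
  choose E hE hEb using fun N => bd2_of_bdd (hehol N) (hele N)
  exact ⟨{ e := e, E := E, C := fun N => Real.exp N
           abd := (bd2_of_bdry hol ale P.a_bdry).1
           ale := ale
           ane := fun z hz => by
             rw [ha z hz]
             refine mul_ne_zero ?_ (Complex.exp_ne_zero _)
             intro h; rw [h] at hα; simp at hα
           asne := by
             filter_upwards [has] with θ h1 h2
             rw [h2, norm_zero] at h1
             exact (Real.exp_pos _).ne h1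
           ebd := hE, ele := hEb, kle := hkle, lim := hlim }⟩

namespace Kap
variable {a : ℂ → ℂ} {as : Tc → ℂ}

lemma asle (K : Kap a as) : ∀ᵐ θ ∂m, ‖as θ‖ ≤ 1 := K.abd.bound K.ale

lemma kbd (K : Kap a as) (N : ℕ) : Bd2 (fun z => a z * K.e N z) (fun θ => as θ * K.E N θ) :=
  bdd_mul K.abd K.asle (K.ebd N)

lemma kble (K : Kap a as) (N : ℕ) : ∀ᵐ θ ∂m, ‖as θ * K.E N θ‖ ≤ 1 := (K.kbd N).bound (K.kle N)

lemma klim (K : Kap a as) : Tendsto (fun N => n2 (fun θ => 1 - as θ * K.E N θ)) atTop (𝓝 0) :=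
  squeeze_zero (fun N => n2_nonneg _)
    (fun N => Real.le_sqrt_of_sq_le (near_one' (K.kbd N) (K.kle N))) K.lim

lemma l0 (K : Kap a as) {X : Tc → ℂ} (hX : Integrable X m) :
    Tendsto (fun N => ∫ θ, ‖(1 - as θ * K.E N θ) * X θ‖ ∂m) atTop (𝓝 0) := by
  have hkm : ∀ N, MemLp (fun θ => 1 - as θ * K.E N θ) 2 m := fun N =>
    (memLp_const (1 : ℂ)).sub (K.kbd N).2.1
  have hk2 : ∀ N, ∀ᵐ θ ∂m, ‖1 - as θ * K.E N θ‖ ≤ 2 := fun N => by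
    filter_upwards [K.kble N] with θ hθ
    have := norm_sub_le 1 (as θ * K.E N θ)
    rw [norm_one] at this; linarith
  rw [Metric.tendsto_atTop]
  intro ε hε
  obtain ⟨V, hV, hXV⟩ := l2_approx hX (ε := ε / 4) (by linarith)
  have hl := K.klim.mul_const (n2 V)
  rw [zero_mul] at hl
  obtain ⟨N0, hN0⟩ := (Metric.tendsto_atTop.1 hl) (ε / 4) (by linarith)
  refine ⟨N0, fun N hN => ?_⟩
  have h1 := hN0 N hN
  rw [Real.dist_0_eq_abs] at h1 ⊢
  rw [abs_of_nonneg (integral_nonneg fun θ => norm_nonneg _)]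
  have h2 := n2_cs (hkm N) hV
  have i1 := (mul_int (hkm N) hV).norm
  have i2 : Integrable (fun θ => 2 * ‖X θ - V θ‖) m := (hX.sub (memLp_int hV)).norm.const_mul 2
  calc _ ≤ ∫ θ, (‖(1 - as θ * K.E N θ) * V θ‖ + 2 * ‖X θ - V θ‖) ∂m := by
        apply integral_mono_of_nonneg (ae_of_all _ fun θ => norm_nonneg _) (i1.add i2)
        filter_upwards [hk2 N] with θ hθ
        have e1 : (1 - as θ * K.E N θ) * X θ = (1 - as θ * K.E N θ) * V θ +
          (1 - as θ * K.E N θ) * (X θ - V θ) := by ring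
        rw [e1]
        refine (norm_add_le _ _).trans ?_
        rw [norm_mul _ (X θ - V θ)]
        have : ‖1 - as θ * K.E N θ‖ * ‖X θ - V θ‖ ≤ 2 * ‖X θ - V θ‖ := by gcongr
        simp only [Pi.add_apply]; linarith
    _ = _ := integral_add i1 i2
    _ < ε := by
        rw [integral_const_mul]
        have := le_abs_self (n2 (fun θ => 1 - as θ * K.E N θ) * n2 V)
        linarith

lemma l1 (K : Kap a as) {X : Tc → ℂ} (hX : Integrable X m) (n : ℤ) :
    Tendsto (fun N => fourierCoeff (fun θ => as θ * K.E N θ * X θ) n) atTop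
      (𝓝 (fourierCoeff X n)) := by
  rw [tendsto_iff_norm_sub_tendsto_zero]
  refine squeeze_zero (fun N => norm_nonneg _) (fun N => ?_) (K.l0 hX)
  have hi : Integrable (fun θ => as θ * K.E N θ * X θ) m :=
    hX.bdd_mul (c := 1) (K.kbd N).2.1.1 (K.kble N)
  rw [norm_sub_rev, ← fc_sub hX hi]
  refine (fc_le _ _).trans (le_of_eq ?_)
  congr 1; ext θ; congr 1; ring

lemma l2 (K : Kap a as) {g : ℂ → ℂ} (hg : HolDisc g) (n : ℕ) :
    Tendsto (fun N => tc (fun z => a z * K.e N z * g z) n) atTop (𝓝 (tc g n)) := by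
  obtain ⟨C, hC, h⟩ := tc_near hg n
  rw [tendsto_iff_norm_sub_tendsto_zero]
  have := K.lim.const_mul C
  rw [mul_zero] at this
  exact squeeze_zero (fun N => norm_nonneg _) (fun N => h _ (K.kbd N).1 (K.kle N)) this
end Kap

/-- cut-off functions -/
def Cut (w : Tc → ℂ) (s κ : ℝ) : Prop :=
  Integrable w m ∧ ∃ ψ : ℂ → ℂ, HolDisc ψ ∧ (∀ z ∈ uDisc, ‖ψ z‖ ≤ 1) ∧ ‖1 - ψ 0‖ ≤ s ∧
    ∀ k, n2 (dil (fun z => ψ z * HH w z) k) ≤ κ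

lemma Cut.smul {w s κ} (h : Cut w s κ) (c : ℂ) : Cut (fun θ => c * w θ) s (‖c‖ * κ) := by
  obtain ⟨hw, ψ, h1, h2, h3, h4⟩ := h
  refine ⟨hw.const_mul c, ψ, h1, h2, h3, fun k => ?_⟩
  have e : dil (fun z => ψ z * HH (fun θ => c * w θ) z) k =
      fun θ => c * dil (fun z => ψ z * HH w z) k θ := by
    ext θ; simp only [dil, hh_smul]; ring
  rw [e, n2_smul]
  have := h4 k
  gcongr

lemma Cut.add {w s κ w' s' κ'} (h : Cut w s κ) (h' : Cut w' s' κ') :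
    Cut (fun θ => w θ + w' θ) (s + s') (κ + κ') := by
  obtain ⟨hw, ψ, h1, h2, h3, h4⟩ := h
  obtain ⟨hw', ψ', h1', h2', h3', h4'⟩ := h'
  refine ⟨hw.add hw', fun z => ψ z * ψ' z, hol_mul h1 h1', fun z hz => ?_, ?_, fun k => ?_⟩
  · rw [norm_mul]; exact mul_le_one₀ (h2 z hz) (norm_nonneg _) (h2' z hz)
  · have e : 1 - ψ 0 * ψ' 0 = (1 - ψ 0) + ψ 0 * (1 - ψ' 0) := by ring
    have h0 := h2 0 (by simp)
    have h5 : ‖ψ 0‖ * ‖1 - ψ' 0‖ ≤ 1 * ‖1 - ψ' 0‖ := by gcongr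
    rw [e]; refine (norm_add_le _ _).trans ?_
    rw [norm_mul]; linarith
  · have m1 : MemLp (dil (fun z => ψ z * HH w z) k) 2 m := dil_memLp (hol_mul h1 (hh_hol hw)) k 2
    have m2 : MemLp (dil (fun z => ψ' z * HH w' z) k) 2 m := dil_memLp (hol_mul h1' (hh_hol hw')) k 2
    have l1 : ∀ᵐ θ ∂m, ‖dil ψ' k θ‖ ≤ 1 := ae_of_all _ fun θ => h2' _ (rb_mem k θ)
    have l2 : ∀ᵐ θ ∂m, ‖dil ψ k θ‖ ≤ 1 := ae_of_all _ fun θ => h2 _ (rb_mem k θ)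
    have m3 := bdd_memLp m1 (dil_cont h1' k).aestronglyMeasurable l1
    have m4 := bdd_memLp m2 (dil_cont h1 k).aestronglyMeasurable l2
    have e : dil (fun z => ψ z * ψ' z * HH (fun θ => w θ + w' θ) z) k =
        fun θ => dil ψ' k θ * dil (fun z => ψ z * HH w z) k θ +
          dil ψ k θ * dil (fun z => ψ' z * HH w' z) k θ := by
      ext θ; simp only [dil]; rw [hh_add hw hw' (rb_mem k θ)]; ring
    rw [e]
    refine (n2_add m3 m4).trans (add_le_add ?_ ?_)
    · refine (n2_mono m1 ?_).trans (h4 k)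
      filter_upwards [l1] with θ hθ
      rw [norm_mul]; exact mul_le_of_le_one_left (norm_nonneg _) hθ
    · refine (n2_mono m2 ?_).trans (h4' k)
      filter_upwards [l2] with θ hθ
      rw [norm_mul]; exact mul_le_of_le_one_left (norm_nonneg _) hθ

lemma cut_pos {w : Tc → ℝ} (hw : Integrable w m) (h0 : ∀ θ, 0 ≤ w θ) {ε t : ℝ} (ht : 0 < t)
    (hε : ∫ θ, w θ ∂m ≤ ε) :
    Cut (fun θ => (w θ : ℂ)) (ε / t) (Real.sqrt (2 * t * ε)) := by
  have hwc : Integrable (fun θ => (w θ : ℂ)) m := hw.ofReal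
  have hre : ∀ z ∈ uDisc, 0 ≤ (HH (fun θ => (w θ : ℂ)) z).re := fun z hz =>
    hh_re_nonneg hw (ae_of_all _ h0) hz
  have hne : ∀ z ∈ uDisc, (t : ℂ) + HH (fun θ => (w θ : ℂ)) z ≠ 0 := by
    intro z hz h
    have := congrArg Complex.re h
    simp at this
    linarith [hre z hz]
  have hhol : HolDisc fun z => (t : ℂ) / ((t : ℂ) + HH (fun θ => (w θ : ℂ)) z) :=
    (differentiableOn_const _).div ((differentiableOn_const _).add (hh_hol hwc)) hne
  have hle : ∀ z ∈ uDisc, ‖(t : ℂ) / ((t : ℂ) + HH (fun θ => (w θ : ℂ)) z)‖ ≤ 1 := by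
    intro z hz
    rw [norm_div, Complex.norm_real, Real.norm_of_nonneg ht.le]
    apply div_le_one_of_le₀ _ (norm_nonneg _)
    refine le_trans ?_ (Complex.re_le_norm _)
    simp [hre z hz]
  have hI : ∫ θ, (w θ : ℂ) ∂m = ((∫ θ, w θ ∂m : ℝ) : ℂ) := integral_ofReal
  have hI0 : 0 ≤ ∫ θ, w θ ∂m := integral_nonneg h0
  have hs : ‖1 - (t : ℂ) / ((t : ℂ) + HH (fun θ => (w θ : ℂ)) 0)‖ ≤ ε / t := by
    rw [hh_zero, hI]
    have e : 1 - (t : ℂ) / ((t : ℂ) + ((∫ θ, w θ ∂m : ℝ) : ℂ)) =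
        (((∫ θ, w θ ∂m) / (t + ∫ θ, w θ ∂m) : ℝ) : ℂ) := by
      have : (t : ℂ) + ((∫ θ, w θ ∂m : ℝ) : ℂ) ≠ 0 := by
        rw [← hI, ← hh_zero]; exact hne 0 (by simp)
      push_cast
      field_simp; ring
    rw [e, Complex.norm_real, Real.norm_of_nonneg (by positivity)]
    apply div_le_div₀ (hI0.trans hε) hε ht; linarith
  refine ⟨hwc, _, hhol, hle, hs, fun k => ?_⟩
  have e : dil (fun z => (t : ℂ) / ((t : ℂ) + HH (fun θ => (w θ : ℂ)) z) * HH (fun θ => (w θ : ℂ)) z) k =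
      fun θ => (t : ℂ) * (1 - dil (fun z => (t : ℂ) / ((t : ℂ) + HH (fun θ => (w θ : ℂ)) z)) k θ) := by
    ext θ; simp only [dil]
    have := hne _ (rb_mem k θ)
    field_simp; ring
  rw [e, n2_smul]
  have h1 := near_one hhol hle k
  have h2 := (Complex.re_le_norm _).trans hs
  rw [Complex.sub_re, Complex.one_re] at h2
  apply Real.le_sqrt_of_sq_le
  rw [mul_pow, Complex.norm_real, Real.norm_of_nonneg ht.le]
  calc _ ≤ t ^ 2 * (2 * (ε / t)) := by
        have h3 := h1.trans (by linarith : _ ≤ 2 * (ε / t))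
        gcongr
    _ = _ := by field_simp

lemma cut_gen {w : Tc → ℂ} (hw : Integrable w m) {ε t : ℝ} (ht : 0 < t)
    (hε : ∫ θ, ‖w θ‖ ∂m ≤ ε) : Cut w (4 * (ε / t)) (4 * Real.sqrt (2 * t * ε)) := by
  have hr : Integrable (fun θ => (w θ).re) m := hw.re
  have hi : Integrable (fun θ => (w θ).im) m := hw.im
  have key : ∀ v : Tc → ℝ, Integrable v m → (∀ θ, |v θ| ≤ ‖w θ‖) →
      Cut (fun θ => ((max (v θ) 0 : ℝ) : ℂ)) (ε / t) (Real.sqrt (2 * t * ε)) := by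
    intro v hv hvw
    refine cut_pos hv.pos_part (fun θ => le_max_right _ _) ht ?_
    refine le_trans ?_ hε
    apply integral_mono hv.pos_part hw.norm
    intro θ
    exact max_le ((le_abs_self _).trans (hvw θ)) (norm_nonneg _)
  have c1 := key _ hr fun θ => Complex.abs_re_le_norm _
  have c2 := (key _ hr.neg fun θ => by simpa using Complex.abs_re_le_norm _).smul (-1)
  have c3 := (key _ hi fun θ => Complex.abs_im_le_norm _).smul I
  have c4 := (key _ hi.neg fun θ => by simpa using Complex.abs_im_le_norm _).smul (-I)
  have c := ((c1.add c2).add c3).add c4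
  have pm : ∀ x : ℝ, max x 0 - max (-x) 0 = x := fun x => by
    rcases le_total x 0 with h | h
    · rw [max_eq_right h, max_eq_left (by linarith)]; ring
    · rw [max_eq_left h, max_eq_right (by linarith)]; ring
  have e : (fun θ => ((max (w θ).re 0 : ℝ) : ℂ) + -1 * ((max ((-fun θ => (w θ).re) θ) 0 : ℝ) : ℂ)
      + I * ((max (w θ).im 0 : ℝ) : ℂ) + -I * ((max ((-fun θ => (w θ).im) θ) 0 : ℝ) : ℂ)) = w := by
    ext θ
    have h1 := congrArg (fun x : ℝ => (x : ℂ)) (pm (w θ).re)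
    have h2 := congrArg (fun x : ℝ => (x : ℂ)) (pm (w θ).im)
    simp only [Pi.neg_apply, ofReal_sub] at h1 h2 ⊢
    linear_combination h1 + I * h2 + Complex.re_add_im (w θ)
  rw [e] at c
  have e1 : ε / t + ε / t + ε / t + ε / t = 4 * (ε / t) := by ring
  have e2 : √(2 * t * ε) + ‖(-1 : ℂ)‖ * √(2 * t * ε) + ‖I‖ * √(2 * t * ε) + ‖-I‖ * √(2 * t * ε) =
    4 * √(2 * t * ε) := by simp; ring
  rwa [e1, e2] at c

/-- Stage B -/
lemma stageB {w : Tc → ℂ} (hw : Integrable w m) (hw0 : HH w 0 = 0) {h : ℂ → ℂ} {M : ℝ}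
    (hh : HolDisc h) (hM : ∀ z ∈ uDisc, ‖h z‖ ≤ M) {G : Tc → ℂ} (hG : AEStronglyMeasurable G m)
    {ns : ℕ → ℕ} (hns : StrictMono ns)
    (hlim : ∀ᵐ θ ∂m, Tendsto (fun i => dil (fun z => h z * HH w z) (ns i) θ) atTop (𝓝 (conj (G θ))))
    {A : ℂ → ℂ} (hA : HolDisc A)
    (hGA : ∀ (ψ : ℂ → ℂ) (Ψ : Tc → ℂ), Bd2 ψ Ψ → (∀ᵐ θ ∂m, ‖Ψ θ‖ ≤ 1) →
      MemLp (fun θ => Ψ θ * G θ) 2 m → ∀ n : ℕ, fourierCoeff (fun θ => Ψ θ * G θ) n =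
        tc (fun z => ψ z * A z) n) (n : ℕ) : tc A n = 0 := by
  have hM0 : 0 ≤ M := (norm_nonneg _).trans (hM 0 (by simp))
  obtain ⟨C, hC, hTc⟩ := tc_near hA n
  have key : ∀ ε : ℝ, 0 < ε → ‖tc A n‖ ≤ 32 * M * ε := by
    intro ε hε
    obtain ⟨w1, hw1, hw2⟩ := l2_approx hw hε
    have hw1i := memLp_int hw1
    have hd : Integrable (fun θ => w θ - w1 θ) m := hw.sub hw1i
    have hbound : ∀ t : ℝ, 0 < t → ‖tc A n‖ ≤
        (C + 2 * (M * (2 * n2 w1))) * Real.sqrt (8 * ε * t⁻¹) + 32 * M * ε := by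
      intro t ht
      obtain ⟨-, ψ, hψ, hψ1, hψ0, hψk⟩ := cut_gen hd ht hw2
      have hδ : 2 - 2 * (ψ 0).re ≤ 8 * ε * t⁻¹ := by
        have := (Complex.re_le_norm _).trans hψ0
        rw [Complex.sub_re, Complex.one_re] at this
        have e : 8 * ε * t⁻¹ = 2 * (4 * (ε / t)) := by ring
        rw [e]; linarith
      have hδ' := Real.sqrt_le_sqrt hδ
      set δ := Real.sqrt (8 * ε * t⁻¹) with hδdef
      set K : ℝ := M * (2 * n2 w1 + 4 * Real.sqrt (2 * t * ε)) with hK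
      have hx : HolDisc fun z => ψ z * (h z * HH w z) := hol_mul hψ (hol_mul hh (hh_hol hw))
      have hxK : ∀ k, n2 (dil (fun z => ψ z * (h z * HH w z)) k) ≤ K := by
        intro k
        have m1 : MemLp (dil (HH w1) k) 2 m := dil_memLp (hh_hol hw1i) k 2
        have m2 : MemLp (dil (fun z => ψ z * HH (fun θ => w θ - w1 θ) z) k) 2 m :=
          dil_memLp (hol_mul hψ (hh_hol hd)) k 2
        have l1 : ∀ᵐ θ ∂m, ‖dil ψ k θ‖ ≤ 1 := ae_of_all _ fun θ => hψ1 _ (rb_mem k θ)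
        have m3 := bdd_memLp m1 (dil_cont hψ k).aestronglyMeasurable l1
        have b1 : n2 (fun θ => dil ψ k θ * dil (HH w1) k θ) ≤ 2 * n2 w1 := by
          refine (n2_mono m1 ?_).trans (hh_n2 hw1 k)
          filter_upwards [l1] with θ hθ
          rw [norm_mul]; exact mul_le_of_le_one_left (norm_nonneg _) hθ
        have b2 := (n2_add m3 m2).trans (add_le_add b1 (hψk k))
        have m4 := (m3.add m2).const_mul (M : ℂ)
        have b3 := n2_smul (M : ℂ) (fun θ => dil ψ k θ * dil (HH w1) k θ +
          dil (fun z => ψ z * HH (fun θ => w θ - w1 θ) z) k θ)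
        rw [Complex.norm_real, Real.norm_of_nonneg hM0] at b3
        refine le_trans (n2_mono m4 ?_) (b3.le.trans ?_)
        · filter_upwards with θ
          have e : dil (fun z => ψ z * (h z * HH w z)) k θ = dil h k θ * (dil ψ k θ * dil (HH w1) k θ +
              dil (fun z => ψ z * HH (fun θ => w θ - w1 θ) z) k θ) := by
            simp only [dil]
            have := hh_add hw1i hd (rb_mem k θ)
            have e2 : (fun θ => w1 θ + (w θ - w1 θ)) = w := by ext; ring
            rw [e2] at this
            rw [this]; ring
          rw [e, norm_mul]
          simp only [norm_mul, Complex.norm_real, Real.norm_of_nonneg hM0]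
          have := hM _ (rb_mem k θ)
          exact mul_le_mul_of_nonneg_right this (norm_nonneg _)
        · rw [hK]; gcongr
      obtain ⟨X, hX, hXK⟩ := bd2_exists hx hxK
      obtain ⟨Ψ, hΨ, hΨ1⟩ := bd2_of_bdd hψ hψ1
      have hXeq : ∀ᵐ θ ∂m, X θ = Ψ θ * conj (G θ) := by
        obtain ⟨n1, hn1, hl1⟩ := hX.bd1.sub hns
        obtain ⟨n3, hn3, hl3⟩ := hΨ.bd1.sub (hns.comp hn1)
        filter_upwards [hlim, hl1, hl3] with θ g1 g2 g3
        have g4 := g2.comp hn3.tendsto_atTop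
        have g5 := g3.mul (g1.comp (hn1.comp hn3).tendsto_atTop)
        exact tendsto_nhds_unique g4 g5
      have hYX : ∀ᵐ θ ∂m, ‖Ψ θ * G θ‖ = ‖X θ‖ := by
        filter_upwards [hXeq] with θ hθ
        rw [hθ, norm_mul, norm_mul, Complex.norm_conj]
      have hY : MemLp (fun θ => Ψ θ * G θ) 2 m :=
        hX.2.1.of_le (hΨ.2.1.1.mul hG) (hYX.mono fun θ h => h.le)
      have hYK : n2 (fun θ => Ψ θ * G θ) ≤ K := (n2_mono hX.2.1 (hYX.mono fun θ h => h.le)).trans hXK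
      have hΨδ : n2 (fun θ => 1 - Ψ θ) ≤ δ :=
        (Real.le_sqrt_of_sq_le (near_one' hΨ hψ1)).trans hδ'
      have m1 : MemLp (fun θ => 1 - Ψ θ) 2 m := (memLp_const (1 : ℂ)).sub hΨ.2.1
      have m2 := conj_memLp m1
      have m3 := conj_memLp hX.2.1
      have hc : n2 (fun θ => conj (1 - Ψ θ)) ≤ δ :=
        (n2_mono m1 (ae_of_all _ fun θ => by rw [Complex.norm_conj])).trans hΨδ
      have hcX : n2 (fun θ => conj (X θ)) ≤ K :=
        (n2_mono hX.2.1 (ae_of_all _ fun θ => by rw [Complex.norm_conj])).trans hXK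
      have hX0 : fourierCoeff (fun θ => conj (X θ)) n = 0 := by
        rw [fc_conj, hX.fc]
        rcases Nat.eq_zero_or_pos n with h0 | h0
        · subst h0
          simp only [Nat.cast_zero, neg_zero]
          rw [tc_zero, hw0]; simp
        · rw [tc_neg _ (by omega)]; simp
      have hfy : ‖fourierCoeff (fun θ => Ψ θ * G θ) n‖ ≤ 2 * (δ * K) := by
        have i1 := mul_int m2 hY
        have i2 := mul_int m1 m3
        have i12 : Integrable (fun θ => conj (1 - Ψ θ) * (Ψ θ * G θ) - (1 - Ψ θ) * conj (X θ)) m :=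
          i1.sub i2
        have e1 : fourierCoeff (fun θ => Ψ θ * G θ) n = fourierCoeff (fun θ =>
            (conj (1 - Ψ θ) * (Ψ θ * G θ) - (1 - Ψ θ) * conj (X θ)) + conj (X θ)) n := by
          apply fc_congr
          filter_upwards [hXeq] with θ hθ
          rw [hθ]; simp only [map_mul, map_sub, map_one, Complex.conj_conj]; ring
        rw [e1, fc_add i12 (memLp_int m3), fc_sub i1 i2, hX0, add_zero]
        refine (norm_sub_le _ _).trans ?_
        have f1 := n2_cs' m2 hY n
        have f2 := n2_cs' m1 m3 n
        have f3 := mul_le_mul hc hYK (n2_nonneg _) (Real.sqrt_nonneg _)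
        have f4 := mul_le_mul hΨδ hcX (n2_nonneg _) (Real.sqrt_nonneg _)
        linarith
      rw [hGA ψ Ψ hΨ hΨ1 hY n] at hfy
      have hT := hTc ψ hψ hψ1
      have hT' : C * Real.sqrt (2 - 2 * (ψ 0).re) ≤ C * δ := by gcongr
      have hfin : ‖tc A n‖ ≤ C * δ + 2 * (δ * K) := by
        have : tc A n = tc (fun z => ψ z * A z) n - (tc (fun z => ψ z * A z) n - tc A n) := by ring
        rw [this]
        refine (norm_sub_le _ _).trans ?_
        linarith
      have hδs : δ * Real.sqrt (2 * t * ε) = 4 * ε := by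
        rw [hδdef, ← Real.sqrt_mul (by positivity)]
        have : 8 * ε * t⁻¹ * (2 * t * ε) = (4 * ε) ^ 2 := by field_simp; norm_num
        rw [this, Real.sqrt_sq (by positivity)]
      refine hfin.trans (le_of_eq ?_)
      rw [hK]
      linear_combination 8 * M * hδs
    have hl : Tendsto (fun t : ℝ => (C + 2 * (M * (2 * n2 w1))) * Real.sqrt (8 * ε * t⁻¹) + 32 * M * ε)
        atTop (𝓝 (32 * M * ε)) := by
      have h1 : Tendsto (fun t : ℝ => Real.sqrt (8 * ε * t⁻¹)) atTop (𝓝 0) := by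
        have := (tendsto_inv_atTop_zero (𝕜 := ℝ)).const_mul (8 * ε)
        rw [mul_zero] at this
        have h2 := (Real.continuous_sqrt.tendsto 0).comp this
        rw [Real.sqrt_zero] at h2; exact h2
      have h3 := (h1.const_mul (C + 2 * (M * (2 * n2 w1)))).add_const (32 * M * ε)
      rw [mul_zero, zero_add] at h3; exact h3
    exact ge_of_tendsto hl ((eventually_gt_atTop 0).mono hbound)
  have hl : Tendsto (fun ε : ℝ => 32 * M * ε) (𝓝[>] 0) (𝓝 0) := by
    have : Tendsto (fun ε : ℝ => 32 * M * ε) (𝓝 0) (𝓝 (32 * M * 0)) :=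
      tendsto_id.const_mul _
    rw [mul_zero] at this
    exact this.mono_left nhdsWithin_le_nhds
  have := ge_of_tendsto hl (eventually_mem_nhdsWithin.mono key)
  exact norm_le_zero_iff.1 this

/-- Function-level membership in `H(b)`. -/
structure HbF (bs as : Tc → ℂ) (F Fp : Tc → ℂ) : Prop where
  f2 : MemLp F 2 m
  p2 : MemLp Fp 2 m
  fn : ∀ n : ℤ, n < 0 → fourierCoeff F n = 0
  pn : ∀ n : ℤ, n < 0 → fourierCoeff Fp n = 0
  rel : ∀ n : ℤ, 0 ≤ n → fourierCoeff (fun θ => conj (bs θ) * F θ - conj (as θ) * Fp θ) n = 0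

lemma int_conj_eq (f : Tc → ℂ) : ∫ θ, conj (f θ) ∂m = conj (∫ θ, f θ ∂m) := integral_conj

lemma fc_int (f : Tc → ℂ) : fourierCoeff f 0 = ∫ θ, f θ ∂m := by
  rw [fc_def]; simp

lemma conj_bdd {f : Tc → ℂ} {C : ℝ} (h : ∀ᵐ θ ∂m, ‖f θ‖ ≤ C) : ∀ᵐ θ ∂m, ‖conj (f θ)‖ ≤ C := by
  filter_upwards [h] with θ hθ
  simpa using hθ

lemma conj_aesm {f : Tc → ℂ} (h : AEStronglyMeasurable f m) :
    AEStronglyMeasurable (fun θ => conj (f θ)) m :=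
  continuous_conj.comp_aestronglyMeasurable h

lemma zpow_memLp {f : Tc → ℂ} (hf : MemLp f 2 m) (n : ℤ) : MemLp (fun θ => bd θ ^ n * f θ) 2 m :=
  bdd_memLp (C := 1) hf (bd_zpow_cont n).aestronglyMeasurable
    (Eventually.of_forall fun θ => (bd_zpow_norm n θ).le)

section
variable {b a : ℂ → ℂ} {bs as F Fp Qp gp U : Tc → ℂ} {u eg : ℂ → ℂ}

lemma HbF.u2 (K : Kap a as) (hb : Bd2 b bs) (hble : ∀ᵐ θ ∂m, ‖bs θ‖ ≤ 1) (h : HbF bs as F Fp) :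
    MemLp (fun θ => conj (bs θ) * F θ - conj (as θ) * Fp θ) 2 m :=
  (bdd_memLp h.f2 (conj_aesm hb.2.1.1) (conj_bdd hble)).sub
    (bdd_memLp h.p2 (conj_aesm K.abd.2.1.1) (conj_bdd K.asle))

lemma HbF.exists_u (K : Kap a as) (hb : Bd2 b bs) (hble : ∀ᵐ θ ∂m, ‖bs θ‖ ≤ 1)
    (h : HbF bs as F Fp) :
    ∃ u, Bd2 u (fun θ => bs θ * conj (F θ) - as θ * conj (Fp θ)) ∧ u 0 = 0 := by
  have e1 : (fun θ => bs θ * conj (F θ) - as θ * conj (Fp θ)) =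
      fun θ => conj (conj (bs θ) * F θ - conj (as θ) * Fp θ) := by
    funext θ; simp
  have h2 := conj_memLp (h.u2 K hb hble)
  rw [e1]
  obtain ⟨u, hu⟩ := ext_H2 h2 (by
    intro n hn
    rw [fc_conj (fun θ => conj (bs θ) * F θ - conj (as θ) * Fp θ), h.rel _ (by omega)]; simp)
  refine ⟨u, hu, ?_⟩
  rw [← tc_zero u, ← hu.fc, fc_conj (fun θ => conj (bs θ) * F θ - conj (as θ) * Fp θ),
    h.rel _ (by omega)]
  simp

lemma stageM1 (K : Kap a as) (hb : Bd2 b bs) (hble : ∀ᵐ θ ∂m, ‖bs θ‖ ≤ 1) (h : HbF bs as F Fp)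
    (n : ℕ) (hq : HbF bs as (fun θ => bd θ ^ (n : ℤ) * F θ) Qp)
    (hu : Bd2 u (fun θ => bs θ * conj (F θ) - as θ * conj (Fp θ))) (hg : Bd2 eg gp) :
    ∫ θ, (Qp θ - bd θ ^ (n : ℤ) * Fp θ) * conj (gp θ) ∂m =
      conj (tc (fun z => u z * eg z / a z) n) := by
  set q : Tc → ℂ := fun θ => Qp θ - bd θ ^ (n : ℤ) * Fp θ with hqd
  have q2 : MemLp q 2 m := hq.p2.sub (zpow_memLp h.p2 n)
  set X : Tc → ℂ := fun θ => conj (q θ) * gp θ with hX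
  have Xi : Integrable X m := mul_int (conj_memLp q2) hg.2.1
  set v : ℂ → ℂ := fun z => u z * eg z / a z with hv
  have vh : HolDisc v := (hu.1.mul hg.1).div K.abd.1 K.ane
  have key : ∀ N, fourierCoeff (fun θ => as θ * K.E N θ * X θ) 0 =
      tc (fun z => a z * K.e N z * v z) n := by
    intro N
    have hW : Bd2 (fun z => K.e N z * eg z) (fun θ => K.E N θ * gp θ) :=
      bdd_mul (K.ebd N) (K.ele N) hg
    have D2 := hq.u2 K hb hble
    have h0 := orth_int D2 hW.2.1 (by
      intro k
      rcases lt_or_ge k 0 with hk | hk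
      · right; rw [hW.fc, tc_neg _ hk]
      · left; exact hq.rel k hk)
    have hUW := (bd1_mul hu hW)
    have e1 : (fun θ => (conj (bs θ) * (bd θ ^ (n:ℤ) * F θ) - conj (as θ) * Qp θ) *
        conj (K.E N θ * gp θ)) = fun θ =>
        conj (bd θ ^ (-(n:ℤ)) * ((bs θ * conj (F θ) - as θ * conj (Fp θ)) * (K.E N θ * gp θ)))
        - conj (as θ * K.E N θ * X θ) := by
      funext θ
      have := bd_ne θ
      simp only [hX, hqd, map_mul, map_sub, map_zpow₀, bd_conj, conj_conj, zpow_neg, inv_zpow,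
        map_inv₀, inv_inv]
      ring
    have I1 : Integrable (fun θ => bd θ ^ (-(n:ℤ)) *
        ((bs θ * conj (F θ) - as θ * conj (Fp θ)) * (K.E N θ * gp θ))) m :=
      zp_int _ (mul_int hu.2.1 hW.2.1)
    have I2 : Integrable (fun θ => as θ * K.E N θ * X θ) m := by
      have := Xi.bdd_mul (c := 1) (K.kbd N).2.1.1 (K.kble N)
      exact this
    have e2 : ∫ θ, (conj (bs θ) * (bd θ ^ (n:ℤ) * F θ) - conj (as θ) * Qp θ) *
        conj (K.E N θ * gp θ) ∂m = conj (fourierCoeff (fun θ =>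
          (bs θ * conj (F θ) - as θ * conj (Fp θ)) * (K.E N θ * gp θ)) n) -
          conj (fourierCoeff (fun θ => as θ * K.E N θ * X θ) 0) := by
      rw [e1, integral_sub (int_conj I1) (int_conj I2), int_conj_eq, int_conj_eq, fc_int, fc_def]
    rw [e2, hUW.fc, ← map_sub] at h0
    have h1 := sub_eq_zero.1 ((map_eq_zero _).1 h0)
    rw [← h1]
    apply tc_congr (hol_mul (K.kbd N).1 vh)
    intro z hz
    have := K.ane z hz
    simp only [hv]
    field_simp
  have t1 := K.l1 Xi 0
  have t2 := K.l2 vh n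
  simp only [key] at t1
  have := tendsto_nhds_unique t1 t2
  rw [← this, fc_int, ← int_conj_eq]
  congr 1; funext θ; simp [hX, hqd]

variable {g : Tc → ℂ}

lemma stageA (K : Kap a as) (hb : Bd2 b bs) (hble : ∀ᵐ θ ∂m, ‖bs θ‖ ≤ 1) (h : HbF bs as F Fp)
    {Q : ℕ → Tc → ℂ} (hq : ∀ n : ℕ, HbF bs as (fun θ => bd θ ^ (n : ℤ) * F θ) (Q n))
    (hu : Bd2 u (fun θ => bs θ * conj (F θ) - as θ * conj (Fp θ))) (hu0 : u 0 = 0)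
    (hg : Bd2 eg gp) (hg2 : MemLp g 2 m)
    (ho : ∀ n : ℕ, ∫ θ, bd θ ^ (n : ℤ) * F θ * conj (g θ) ∂m + ∫ θ, Q n θ * conj (gp θ) ∂m = 0) :
    HH (fun θ => F θ * conj (g θ) + Fp θ * conj (gp θ)) 0 = 0 ∧ ∀ z ∈ uDisc,
      HH (fun θ => F θ * conj (g θ) + Fp θ * conj (gp θ)) z =
      2 * (Pw (fun θ => F θ * conj (g θ) + Fp θ * conj (gp θ)) z +
        conj (u z * eg z / a z)) := by
  set w : Tc → ℂ := fun θ => F θ * conj (g θ) + Fp θ * conj (gp θ) with hw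
  set v : ℂ → ℂ := fun z => u z * eg z / a z with hv
  have vh : HolDisc v := (hu.1.mul hg.1).div K.abd.1 K.ane
  have v0 : v 0 = 0 := by simp [hv, hu0]
  have i1 : Integrable (fun θ => F θ * conj (g θ)) m := mul_int h.f2 (conj_memLp hg2)
  have i2 : Integrable (fun θ => Fp θ * conj (gp θ)) m := mul_int h.p2 (conj_memLp hg.2.1)
  have wi : Integrable w m := i1.add i2
  have fcw : ∀ n : ℕ, fourierCoeff w (-(n : ℤ)) = - conj (tc v n) := by
    intro n
    have := stageM1 K hb hble h n (hq n) hu hg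
    rw [← this]
    have e : (fun θ => (Q n θ - bd θ ^ (n : ℤ) * Fp θ) * conj (gp θ)) =
        fun θ => Q n θ * conj (gp θ) - bd θ ^ (n : ℤ) * (Fp θ * conj (gp θ)) := by
      funext θ; ring
    have e' : (fun θ => bd θ ^ (-(-(n : ℤ))) * w θ) = fun θ =>
        bd θ ^ (n : ℤ) * F θ * conj (g θ) + bd θ ^ (n : ℤ) * (Fp θ * conj (gp θ)) := by
      funext θ; simp only [hw, neg_neg]; ring
    have i3 : Integrable (fun θ => bd θ ^ (n : ℤ) * F θ * conj (g θ)) m := by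
      simpa only [mul_assoc] using zp_int n i1
    rw [e, integral_sub (mul_int (hq n).p2 (conj_memLp hg.2.1)) (zp_int n i2), fc_def, e',
      integral_add i3 (zp_int n i2)]
    linear_combination ho n
  have fcw' : ∀ n : ℕ, fourierCoeff (fun θ => conj (w θ)) n = - tc v n := by
    intro n
    rw [fc_conj, fcw]; simp
  have tv0 : tc v 0 = 0 := by rw [tc_zero, v0]
  refine ⟨?_, ?_⟩
  · rw [hh_zero, ← fc_int]
    have := fcw 0
    simpa [tv0] using this
  · intro z hz
    have e : HH (fun θ => conj (w θ)) z = (-2) * v z := by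
      refine eq_of_tc (g := fun z => (-2) * v z) (hh_hol (int_conj wi)) (vh.const_mul _) ?_ hz
      intro n
      rw [hh_tc (int_conj wi), fcw', tc_smul vh]
      rcases Nat.eq_zero_or_pos n with rfl | hn
      · simp [tv0]
      · simp [dc, hn.ne']
    have : conj (v z) = - conj (HH (fun θ => conj (w θ)) z) / 2 := by
      rw [e, map_mul, map_neg, map_ofNat]; ring
    show HH w z = 2 * (Pw w z + conj (v z))
    rw [this, Pw]; ring

/-- Boundary limit of the Herglotz transform. -/
lemma stageA' (K : Kap a as) (ha : IsBdry a as) {w : Tc → ℂ} (hw : Integrable w m)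
    (hu : Bd2 u U) (hg : Bd2 eg gp)
    (hH : ∀ z ∈ uDisc, HH w z = 2 * (Pw w z + conj (u z * eg z / a z))) :
    ∃ ns : ℕ → ℕ, StrictMono ns ∧ ∀ᵐ θ ∂m, Tendsto (fun i => dil (HH w) (ns i) θ) atTop
      (𝓝 (2 * (w θ + conj (U θ * gp θ / as θ)))) := by
  obtain ⟨n1, s1, l1⟩ := sub_ae (pw_int hw) hw (pw_conv hw)
  obtain ⟨n2, s2, l2⟩ := hu.bd1.sub s1
  obtain ⟨n3, s3, l3⟩ := hg.bd1.sub (s1.comp s2)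
  refine ⟨n1 ∘ n2 ∘ n3, s1.comp (s2.comp s3), ?_⟩
  filter_upwards [l1, l2, l3, ha.dil, K.asne] with θ h1 h2 h3 h4 h5
  have t1 := h1.comp (s2.comp s3).tendsto_atTop
  have t2 := h2.comp s3.tendsto_atTop
  have t4 := h4.comp (s1.comp (s2.comp s3)).tendsto_atTop
  have t := (t1.add ((continuous_conj.tendsto _).comp ((t2.mul h3).div t4 h5))).const_mul 2
  refine t.congr ?_
  intro i
  simp only [dil, Function.comp]
  rw [hH _ (rb_mem _ _)]
  rfl

lemma stageC (K : Kap a as) (hb : Bd2 b bs) (hble : ∀ᵐ θ ∂m, ‖bs θ‖ ≤ 1) {d : ℂ → ℂ}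
    (hd : Bd2 d g) (hg : Bd2 eg gp) (ψ : ℂ → ℂ) (Ψ : Tc → ℂ) (hψ : Bd2 ψ Ψ)
    (hΨ : ∀ᵐ θ ∂m, ‖Ψ θ‖ ≤ 1) (hm : MemLp (fun θ => Ψ θ * (g θ + bs θ * gp θ / as θ)) 2 m) (n : ℕ) :
    fourierCoeff (fun θ => Ψ θ * (g θ + bs θ * gp θ / as θ)) n =
      tc (fun z => ψ z * (d z + b z * eg z / a z)) n := by
  have hA : HolDisc (fun z => ψ z * (d z + b z * eg z / a z)) :=
    hψ.1.mul (hd.1.add ((hb.1.mul hg.1).div K.abd.1 K.ane))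
  refine tendsto_nhds_unique (K.l1 (memLp_int hm) n) ((K.l2 hA n).congr ?_)
  intro N
  have B1 := bdd_mul (K.kbd N) (K.kble N) (bdd_mul hψ hΨ hd)
  have B2 := bdd_mul (K.ebd N) (K.ele N) (bdd_mul hψ hΨ (bdd_mul hb hble hg))
  have B := B1.add B2
  have e1 : fourierCoeff (fun θ => as θ * K.E N θ * (Ψ θ * (g θ + bs θ * gp θ / as θ))) n =
      fourierCoeff (fun θ => as θ * K.E N θ * (Ψ θ * g θ) + K.E N θ * (Ψ θ * (bs θ * gp θ))) n := by
    apply fc_congr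
    filter_upwards [K.asne] with θ hθ
    field_simp
  rw [e1, B.fc]
  apply tc_congr B.1
  intro z hz
  have := K.ane z hz
  field_simp

lemma stageE (K : Kap a as) (hb : Bd2 b bs) (hble : ∀ᵐ θ ∂m, ‖bs θ‖ ≤ 1)
    (hpy : ∀ᵐ θ ∂m, ‖as θ‖ ^ 2 + ‖bs θ‖ ^ 2 = 1) (h : HbF bs as g gp)
    (h0 : ∀ᵐ θ ∂m, as θ * g θ + bs θ * gp θ = 0) : g =ᵐ[m] 0 ∧ gp =ᵐ[m] 0 := by
  set V : Tc → ℂ := fun θ => conj (bs θ) * g θ - conj (as θ) * gp θ with hV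
  have V2 : MemLp V 2 m := h.u2 K hb hble
  have e : ∀ᵐ θ ∂m, g θ = bs θ * V θ ∧ gp θ = - (as θ * V θ) := by
    filter_upwards [hpy, h0] with θ h1 h2
    have h3 : as θ * conj (as θ) + bs θ * conj (bs θ) = 1 := by
      rw [mul_conj, mul_conj, normSq_eq_norm_sq, normSq_eq_norm_sq]
      exact_mod_cast h1
    constructor
    · simp only [hV]; linear_combination conj (as θ) * h2 - g θ * h3
    · simp only [hV]; linear_combination conj (bs θ) * h2 - gp θ * h3
  obtain ⟨eg, hg⟩ := ext_H2 h.p2 h.pn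
  have z1 : ∀ n : ℤ, fourierCoeff V n = 0 := by
    intro n
    rcases lt_or_ge n 0 with hn | hn
    · refine tendsto_nhds_unique (K.l1 (memLp_int V2) n) ?_
      have : ∀ N, fourierCoeff (fun θ => as θ * K.E N θ * V θ) n = 0 := by
        intro N
        have B := bdd_mul (K.ebd N) (K.ele N) hg
        have e1 : fourierCoeff (fun θ => as θ * K.E N θ * V θ) n =
          fourierCoeff (fun θ => (-1) * (K.E N θ * gp θ)) n := by
          apply fc_congr
          filter_upwards [e] with θ hθ
          rw [hθ.2]; ring
        rw [e1, fc_smul, B.fc, tc_neg _ hn, mul_zero]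
      simp only [this]
      exact tendsto_const_nhds
    · exact h.rel n hn
  have hz := fc_zero_ae V2 z1
  constructor
  · filter_upwards [hz, e] with θ h1 h2
    rw [h2.1, h1]; simp
  · filter_upwards [hz, e] with θ h1 h2
    rw [h2.2, h1]; simp

lemma main_fn (K : Kap a as) (ha : IsBdry a as) (hb : Bd2 b bs) (hble : ∀ᵐ θ ∂m, ‖bs θ‖ ≤ 1)
    (hpy : ∀ᵐ θ ∂m, ‖as θ‖ ^ 2 + ‖bs θ‖ ^ 2 = 1) {f : ℂ → ℂ} (hf : HolDisc f) (hfb : IsBdry f F)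
    {c : ℝ} (hc : 0 < c) (hcf : ∀ z ∈ uDisc, c ≤ ‖f z‖) (h : HbF bs as F Fp)
    {Q : ℕ → Tc → ℂ} (hq : ∀ n : ℕ, HbF bs as (fun θ => bd θ ^ (n : ℤ) * F θ) (Q n))
    (hg : HbF bs as g gp)
    (ho : ∀ n : ℕ, ∫ θ, bd θ ^ (n : ℤ) * F θ * conj (g θ) ∂m + ∫ θ, Q n θ * conj (gp θ) ∂m = 0) :
    g =ᵐ[m] 0 ∧ gp =ᵐ[m] 0 := by
  apply stageE K hb hble hpy hg
  obtain ⟨d, hd⟩ := ext_H2 hg.f2 hg.fn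
  obtain ⟨eg, heg⟩ := ext_H2 hg.p2 hg.pn
  obtain ⟨u, hu, hu0⟩ := h.exists_u K hb hble
  obtain ⟨hw0, hH⟩ := stageA K hb hble h hq hu hu0 heg hg.f2 ho
  have wi : Integrable (fun θ => F θ * conj (g θ) + Fp θ * conj (gp θ)) m :=
    (mul_int h.f2 (conj_memLp hg.f2)).add (mul_int h.p2 (conj_memLp hg.p2))
  obtain ⟨ns, hns, hl⟩ := stageA' K ha wi hu heg hH
  have fne : ∀ z ∈ uDisc, f z ≠ 0 := fun z hz h0 => by
    have := hcf z hz
    rw [h0, norm_zero] at this; linarith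
  have Fne : ∀ᵐ θ ∂m, F θ ≠ 0 := by
    filter_upwards [hfb.dil] with θ hθ h0
    have := ge_of_tendsto' hθ.norm (fun k => hcf _ (rb_mem k θ))
    rw [h0, norm_zero] at this; linarith
  have hhol : HolDisc (fun z => (2 * f z)⁻¹) :=
    (hf.const_mul 2).inv (fun z hz => mul_ne_zero two_ne_zero (fne z hz))
  have hM : ∀ z ∈ uDisc, ‖(2 * f z)⁻¹‖ ≤ (2 * c)⁻¹ := by
    intro z hz
    rw [norm_inv, norm_mul]
    have := hcf z hz
    simp only [norm_ofNat]
    gcongr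
  set G : Tc → ℂ := fun θ => g θ + bs θ * gp θ / as θ with hG
  have Gm : AEStronglyMeasurable G m := by
    have m1 := hb.2.1.1.aemeasurable
    have m2 := K.abd.2.1.1.aemeasurable
    have m3 := hg.f2.1.aemeasurable
    have m4 := hg.p2.1.aemeasurable
    exact (m3.add ((m1.mul m4).div m2)).aestronglyMeasurable
  have hlim : ∀ᵐ θ ∂m, Tendsto (fun i => dil (fun z => (2 * f z)⁻¹ *
      HH (fun θ => F θ * conj (g θ) + Fp θ * conj (gp θ)) z) (ns i) θ) atTop (𝓝 (conj (G θ))) := by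
    filter_upwards [hl, hfb.dil, Fne, K.asne] with θ h1 h2 h3 h4
    have h4' : conj (as θ) ≠ 0 := (map_ne_zero _).2 h4
    have t2 := ((h2.comp hns.tendsto_atTop).const_mul 2).inv₀ (mul_ne_zero two_ne_zero h3)
    have t := t2.mul h1
    have e : conj (G θ) = (2 * F θ)⁻¹ * (2 * ((F θ * conj (g θ) + Fp θ * conj (gp θ)) +
        conj ((bs θ * conj (F θ) - as θ * conj (Fp θ)) * gp θ / as θ))) := by
      simp only [hG, map_add, map_mul, map_div₀, map_sub, conj_conj]
      field_simp
      ring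
    rw [e]
    exact t
  set A : ℂ → ℂ := fun z => d z + b z * eg z / a z with hA
  have Ah : HolDisc A := hd.1.add ((hb.1.mul heg.1).div K.abd.1 K.ane)
  have A0 := stageB wi hw0 hhol hM Gm hns hlim Ah
    (fun ψ Ψ h1 h2 h3 n => stageC K hb hble hd heg ψ Ψ h1 h2 h3 n)
  have A0' : ∀ z ∈ uDisc, A z = 0 := by
    intro z hz
    have := hol_ps Ah hz
    simp only [A0, zero_mul] at this
    exact this.unique hasSum_zero
  have B := (bdd_mul K.abd K.asle hd).add (bdd_mul hb hble heg)
  have := fc_zero_ae B.2.1 (by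
    intro n
    have z0 : HolDisc (fun _ : ℂ => (0:ℂ)) := differentiableOn_const _
    rw [B.fc, tc_congr z0 (fun z hz => ?_) n]
    · rcases lt_or_ge n 0 with hn | hn
      · exact tc_neg _ hn
      · lift n to ℕ using hn
        exact ps_uniq (c := fun _ => 0) (fun z _ => by simpa using hasSum_zero) n
    · have h1 := A0' z hz
      have h2 := K.ane z hz
      simp only [hA] at h1
      field_simp at h1
      linear_combination h1)
  exact this

end

lemma fcL_exists {φ : Tc → ℂ} (hφ : AEStronglyMeasurable φ m) (h1 : ∀ᵐ θ ∂m, ‖φ θ‖ ≤ 1) (n : ℤ) :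
    ∃ L : L2 →L[ℂ] ℂ, ∀ F : L2, L F = fourierCoeff (fun θ => φ θ * (F : Tc → ℂ) θ) n := by
  have hi : ∀ F : L2, MemLp (fun θ => φ θ * (F : Tc → ℂ) θ) 2 m :=
    fun F => bdd_memLp (Lp.memLp F) hφ h1
  let L : L2 →ₗ[ℂ] ℂ :=
    { toFun := fun F => fourierCoeff (fun θ => φ θ * (F : Tc → ℂ) θ) n
      map_add' := by
        intro F G
        rw [← fc_add (memLp_int (hi F)) (memLp_int (hi G))]
        apply fc_congr
        filter_upwards [Lp.coeFn_add F G] with θ hθ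
        rw [hθ, Pi.add_apply]; ring
      map_smul' := by
        intro c F
        rw [RingHom.id_apply, smul_eq_mul, ← fc_smul]
        apply fc_congr
        filter_upwards [Lp.coeFn_smul c F] with θ hθ
        rw [hθ, Pi.smul_apply, smul_eq_mul]; ring }
  refine ⟨L.mkContinuous 1 ?_, fun F => rfl⟩
  intro F
  have h2 : n2 (F : Tc → ℂ) = ‖F‖ := by rw [n2, Lp.norm_def]
  rw [one_mul, ← h2]
  refine (fc_le _ n).trans ((n1_le_n2 (hi F)).trans (n2_mono (Lp.memLp F) ?_))
  filter_upwards [h1] with θ hθ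
  rw [norm_mul]
  exact mul_le_of_le_one_left (norm_nonneg _) hθ

def fstL : HbP →L[ℂ] L2 := WithLp.fstL 2 ℂ L2 L2
def sndL : HbP →L[ℂ] L2 := WithLp.sndL 2 ℂ L2 L2
lemma fstL_eq (p : HbP) : fstL p = fst2 p := rfl
lemma sndL_eq (p : HbP) : sndL p = snd2 p := rfl

lemma b_facts (P : BPair) : Bd2 P.b P.bs ∧ ∀ᵐ θ ∂m, ‖P.bs θ‖ ≤ 1 :=
  bd2_of_bdry P.b_hol P.b_le_one P.b_bdry

lemma hbF_of (P : BPair) {p : HbP} (h : p ∈ HbSet P) :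
    HbF P.bs P.as' (fst2 p) (snd2 p) :=
  ⟨Lp.memLp _, Lp.memLp _, h.1, h.2.1, h.2.2⟩

lemma hb_submodule (P : BPair) : ∃ M : Submodule ℂ HbP, IsClosed (M : Set HbP) ∧
    (M : Set HbP) = HbSet P := by
  obtain ⟨K⟩ := kap_exists P
  obtain ⟨hb, hble⟩ := b_facts P
  choose L1 hL1 using fun n => fcL_exists (φ := fun _ => 1) aestronglyMeasurable_const (by simp) n
  choose L2' hL2 using fun n => fcL_exists (conj_aesm hb.2.1.1) (conj_bdd hble) n
  choose L3 hL3 using fun n => fcL_exists (conj_aesm K.abd.2.1.1) (conj_bdd K.asle) n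
  simp only [one_mul] at hL1
  let M : Submodule ℂ HbP :=
    (⨅ n : {n : ℤ // n < 0}, LinearMap.ker ((L1 n).comp fstL).toLinearMap) ⊓
    ((⨅ n : {n : ℤ // n < 0}, LinearMap.ker ((L1 n).comp sndL).toLinearMap) ⊓
    (⨅ n : {n : ℤ // 0 ≤ n}, LinearMap.ker
      ((L2' n).comp fstL - (L3 n).comp sndL).toLinearMap))
  have hM : (M : Set HbP) = HbSet P := by
    ext p
    have r : ∀ n, fourierCoeff (fun θ => conj (P.bs θ) * (fst2 p : Tc → ℂ) θ -
        conj (P.as' θ) * (snd2 p : Tc → ℂ) θ) n = L2' n (fst2 p) - L3 n (snd2 p) := by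
      intro n
      rw [hL2, hL3, fc_sub]
      · exact memLp_int (bdd_memLp (Lp.memLp _) (conj_aesm hb.2.1.1) (conj_bdd hble))
      · exact memLp_int (bdd_memLp (Lp.memLp _) (conj_aesm K.abd.2.1.1) (conj_bdd K.asle))
    simp only [HbSet, HbMem, H2, mem_setOf_eq, r]
    simp only [SetLike.mem_coe, M, Submodule.mem_inf, Submodule.mem_iInf, LinearMap.mem_ker,
      ContinuousLinearMap.coe_coe, ContinuousLinearMap.comp_apply, ContinuousLinearMap.sub_apply,
      fstL_eq, sndL_eq, hL1, Subtype.forall]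
  refine ⟨M, ?_, hM⟩
  have c1 : ∀ L : HbP →L[ℂ] ℂ, IsClosed ((LinearMap.ker L.toLinearMap : Submodule ℂ HbP) : Set HbP) :=
    fun L => L.isClosed_ker
  simp only [M, Submodule.coe_inf, Submodule.coe_iInf]
  exact (isClosed_iInter fun n => c1 _).inter ((isClosed_iInter fun n => c1 _).inter
    (isClosed_iInter fun n => c1 _))

lemma inner_hb (x y : HbP) : inner ℂ x y =
    ∫ θ, (fst2 y : Tc → ℂ) θ * conj ((fst2 x : Tc → ℂ) θ) ∂m +
    ∫ θ, (snd2 y : Tc → ℂ) θ * conj ((snd2 x : Tc → ℂ) θ) ∂m := by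
  rw [WithLp.prod_inner_apply, L2.inner_def, L2.inner_def]
  rfl

lemma orth_zero (P : BPair) (f : ℂ → ℂ) (p : HbP) (hp : p ∈ HbSet P)
    (hhol : HolDisc f) (hbd : IsBdry f (fst2 p : Tc → ℂ))
    (hinf : ∃ c : ℝ, 0 < c ∧ ∀ z ∈ uDisc, c ≤ ‖f z‖) (Zf : ℕ → HbP) (hZ : ZFamily P p Zf)
    (g : HbP) (hg : g ∈ HbSet P) (ho : ∀ n, inner ℂ g (Zf n) = 0) : g = 0 := by
  obtain ⟨K⟩ := kap_exists P
  obtain ⟨hb, hble⟩ := b_facts P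
  obtain ⟨c, hc, hcf⟩ := hinf
  have e : ∀ n : ℕ, (fst2 (Zf n) : Tc → ℂ) =ᵐ[m] fun θ => bd θ ^ (n : ℤ) * (fst2 p : Tc → ℂ) θ := by
    intro n
    simpa only [zpow_natCast] using (hZ n).2
  have hq : ∀ n : ℕ, HbF P.bs P.as' (fun θ => bd θ ^ (n : ℤ) * (fst2 p : Tc → ℂ) θ)
      (snd2 (Zf n)) := by
    intro n
    have h := hbF_of P (hZ n).1
    refine ⟨h.f2.ae_eq (e n), h.p2, fun k hk => ?_, h.pn, fun k hk => ?_⟩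
    · rw [← fc_congr (e n)]; exact h.fn k hk
    · rw [← h.rel k hk]
      apply fc_congr
      filter_upwards [e n] with θ hθ
      rw [hθ]
  have := main_fn K P.a_bdry hb hble P.pyth hhol hbd hc hcf (hbF_of P hp) hq (hbF_of P hg) (by
    intro n
    rw [← ho n, inner_hb]
    congr 1
    apply integral_congr_ae
    filter_upwards [e n] with θ hθ
    rw [hθ])
  have z1 : fst2 g = 0 := (Lp.eq_zero_iff_ae_eq_zero).2 this.1
  have z2 : snd2 g = 0 := (Lp.eq_zero_iff_ae_eq_zero).2 this.2
  apply (WithLp.equiv 2 (L2 × L2)).injective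
  exact Prod.ext z1 z2

/-- Let `f ∈ H(b)` satisfy `inf_{z ∈ 𝔻} |f(z)| > 0`. Then `f` is cyclic
for `S_b`. -/
theorem stmt_12 (P : BPair) (f : ℂ → ℂ) (p : HbP) (hp : p ∈ HbSet P)
    (hhol : HolDisc f) (hbd : IsBdry f (fst2 p : Tc → ℂ))
    (hinf : ∃ c : ℝ, 0 < c ∧ ∀ z ∈ uDisc, c ≤ ‖f z‖) :
    CyclicSb P p := by
  refine ⟨hp, fun Zf hZ => ?_⟩
  obtain ⟨M, hMc, hM⟩ := hb_submodule P
  have hsub : Submodule.span ℂ (Set.range Zf) ≤ M := by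
    rw [Submodule.span_le]
    rintro _ ⟨n, rfl⟩
    rw [hM]
    exact (hZ n).1
  have hcl : closure (↑(Submodule.span ℂ (Set.range Zf)) : Set HbP) ⊆ M :=
    closure_minimal hsub hMc
  apply Subset.antisymm (hM ▸ hcl)
  intro x hx
  set N : Submodule ℂ HbP := (Submodule.span ℂ (Set.range Zf)).topologicalClosure with hN
  have hNc : IsClosed (N : Set HbP) := Submodule.isClosed_topologicalClosure _
  haveI : CompleteSpace N := hNc.completeSpace_coe
  obtain ⟨y, hy, z, hz, hxyz⟩ := N.exists_add_mem_mem_orthogonal x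
  have hyM : y ∈ M := hcl hy
  have hxM : x ∈ M := by
    have : x ∈ (M : Set HbP) := by rw [hM]; exact hx
    exact this
  have hzM : z ∈ M := by
    have : z = x - y := by rw [hxyz]; abel
    rw [this]; exact M.sub_mem hxM hyM
  have hz0 : z = 0 := by
    apply orth_zero P f p hp hhol hbd hinf Zf hZ z
    · rw [← hM]; exact hzM
    · intro n
      apply Submodule.inner_left_of_mem_orthogonal _ hz
      exact Submodule.le_topologicalClosure _ (Submodule.subset_span ⟨n, rfl⟩)
  rw [hxyz, hz0, add_zero]
  exact hy

end
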